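/- Consider a compound discrete memoryless channel with K components W₁, …, W_K : 𝒳 → 𝒮 → PMF 𝒴 over finite alphabets 𝒳, 𝒮, 𝒴 with state distribution P_S : PMF 𝒮 and states known non-causally only at the transmitter. Assume the components are stochastically degraded in a chain W_K ⪯ W_{K−1} ⪯ ⋯ ⪯ W₁, i.e., for each k ∈ {1,…,K−1} there is a stochastic map W̃_k : 𝒴 → PMF 𝒴 with W_{k+1} x s = (W_k x s).bind W̃_k for all (x,s). Then the capacity, i.e., the supremum of all achievable rates, equals the supremum, over all choices of nonempty finite auxiliary alphabets 𝒱₁,…,𝒱_K (say 𝒱_k = Fin n_k with n_k ≥ 1) and kernels Q_K : 𝒮 → PMF 𝒱_K, Q_k : 𝒮 × 𝒱_{k+1} → PMF 𝒱_k for k < K, and Q_X : 𝒮 × 𝒱₁ → PMF 𝒳, of min_{k∈{1,…,K}} [ I(V_k;Y_k) − I(V_k;S) ], where the informations are computed from the joint pmf p_k(v_K,…,v₁,s,x,y) = P_S(s) · Q_K(s)(v_K) · ∏_{j=1}^{K−1} Q_j(s,v_{j+1})(v_j) · Q_X(s,v₁)(x) · (W_k x s)(y). -/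

import Mathlib

open scoped BigOperators

noncomputable section

namespace CompoundDegraded

variable {𝒳 𝒮 𝒴 : Type} [Fintype 𝒳] [Fintype 𝒮] [Fintype 𝒴]

/-- Mutual information `I(A;B)` of a joint (real-valued) pmf `p` on `A × B`,
with natural logarithm and the convention `0·log(·) = 0`. -/
def mutualInfo {A B : Type} [Fintype A] [Fintype B] (p : A × B → ℝ) : ℝ :=
  ∑ a : A, ∑ b : B,
    p (a, b) *
      Real.log (p (a, b) / ((∑ b' : B, p (a, b')) * (∑ a' : A, p (a', b))))

/-- Average (over i.i.d. states with pmf `PS`) error probability of message `m`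
for the channel component `θ`, for the `(n,M)` code `(φ, ψ)`. -/
def avgError {Θ : Type} (W : Θ → 𝒳 → 𝒮 → PMF 𝒴) (PS : PMF 𝒮) {n M : ℕ}
    (φ : Fin M → (Fin n → 𝒮) → (Fin n → 𝒳)) (ψ : (Fin n → 𝒴) → Fin M)
    (m : Fin M) (θ : Θ) : ℝ :=
  ∑ s : Fin n → 𝒮, (∏ i, (PS (s i)).toReal) *
    ∑ y : Fin n → 𝒴,
      (∏ i, ((W θ (φ m s i) (s i)) (y i)).toReal) * (if ψ y ≠ m then 1 else 0)

/-- `R` is an achievable rate for the compound DMC `{W θ}` with i.i.d. states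
(pmf `PS`) known non-causally at the transmitter only. -/
def IsAchievable {Θ : Type} (W : Θ → 𝒳 → 𝒮 → PMF 𝒴) (PS : PMF 𝒮) (R : ℝ) : Prop :=
  0 ≤ R ∧
    ∀ ε ∈ Set.Ioo (0 : ℝ) 1, ∀ γ ∈ Set.Ioo (0 : ℝ) 1, ∃ n₀ : ℕ, ∀ n ≥ n₀,
      ∃ M : ℕ, 1 ≤ M ∧
        ∃ (φ : Fin M → (Fin n → 𝒮) → (Fin n → 𝒳)) (ψ : (Fin n → 𝒴) → Fin M),
          Real.log M / n ≥ R - γ ∧ ∀ m θ, avgError W PS φ ψ m θ ≤ ε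

/-- The joint pmf
`p_k(v_K,…,v_1,s,x,y) = P_S(s)·Q_K(s)(v_K)·∏_{j=1}^{K−1} Q_j(s,v_{j+1})(v_j)
  ·Q_X(s,v_1)(x)·(W_k x s)(y)`
of the Markov-chain auxiliary structure used for the degraded compound channel
(`0`-based indexing: coordinate `0` is `V_1`, coordinate `K−1` is `V_K`). -/
def jointChain {K : ℕ} (hK : 1 ≤ K) (PS : PMF 𝒮) (n : ℕ → ℕ)
    (Qtop : 𝒮 → PMF (Fin (n (K - 1))))
    (Q : (j : ℕ) → 𝒮 → Fin (n (j + 1)) → PMF (Fin (n j)))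
    (QX : 𝒮 → Fin (n 0) → PMF 𝒳) (Wk : 𝒳 → 𝒮 → PMF 𝒴)
    (v : (j : Fin K) → Fin (n j.val)) (s : 𝒮) (x : 𝒳) (y : 𝒴) : ℝ :=
  (PS s).toReal * ((Qtop s) (v ⟨K - 1, by omega⟩)).toReal *
    (∏ j ∈ (Finset.range (K - 1)).attach,
      ((Q j.1 s (v ⟨j.1 + 1, by have := Finset.mem_range.mp j.2; omega⟩))
        (v ⟨j.1, by have := Finset.mem_range.mp j.2; omega⟩)).toReal) *
    ((QX s (v ⟨0, by omega⟩)) x).toReal * ((Wk x s) y).toReal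

lemma marg {ι α : Type} [Fintype ι] [DecidableEq ι] [Fintype α] (w : ι → α → ℝ) (i : ι)
    (hw : ∑ a, w i a = 1) (f : (ι → α) → ℝ)
    (hf : ∀ c v, f (Function.update c i v) = f c) (g : α → ℝ) :
    ∑ c : ι → α, (∏ j, w j (c j)) * f c * g (c i) =
      (∑ c : ι → α, (∏ j, w j (c j)) * f c) * ∑ a, w i a * g a := by
  let e : (ι → α) × α → (ι → α) × α := fun p => (Function.update p.1 i p.2, p.1 i)
  have he : Function.Involutive e := by
    rintro ⟨c, b⟩
    simp [e]
  have key : ∀ (c : ι → α) (b : α),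
      (∏ j, w j (c j)) * w i b = (∏ j, w j (Function.update c i b j)) * w i (c i) := by
    intro c b
    rw [← Finset.mul_prod_erase Finset.univ _ (Finset.mem_univ i),
      ← Finset.mul_prod_erase Finset.univ (fun j => w j (Function.update c i b j))
        (Finset.mem_univ i)]
    have : ∏ j ∈ Finset.univ.erase i, w j (Function.update c i b j)
        = ∏ j ∈ Finset.univ.erase i, w j (c j) := by
      apply Finset.prod_congr rfl
      intro j hj
      rw [Function.update_of_ne (Finset.ne_of_mem_erase hj)]
    rw [this]
    simp
    ring
  have h1 : ∑ p : (ι → α) × α, (∏ j, w j (p.1 j)) * f p.1 * (w i p.2 * g p.2)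
      = ∑ p : (ι → α) × α, (∏ j, w j (p.1 j)) * f p.1 * (w i p.2 * g (p.1 i)) := by
    rw [← Equiv.sum_comp he.toPerm]
    apply Finset.sum_congr rfl
    rintro ⟨c, b⟩ _
    have hk := key c b
    simp only [Function.Involutive.coe_toPerm, e, hf]
    linear_combination (f c * g (c i)) * (-hk)
  rw [Fintype.sum_prod_type, Fintype.sum_prod_type] at h1
  rw [Finset.sum_mul]
  simp_rw [Finset.mul_sum]
  rw [h1]
  apply Finset.sum_congr rfl
  intro c _
  dsimp only
  rw [← Finset.mul_sum, ← Finset.sum_mul, hw]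
  ring

lemma sum_pi_prod {ι α : Type} [Fintype ι] [DecidableEq ι] [Fintype α] (w : ι → α → ℝ) :
    ∑ c : ι → α, ∏ j, w j (c j) = ∏ j, ∑ a, w j a := by
  rw [Finset.prod_univ_sum]
  simp

lemma sum_pi_one {ι α : Type} [Fintype ι] [Fintype α] [DecidableEq ι] (w : ι → α → ℝ)
    (hw : ∀ i, ∑ a, w i a = 1) : ∑ c : ι → α, ∏ j, w j (c j) = 1 := by
  have := sum_pi_prod w
  simp only [hw, Finset.prod_const_one] at this
  convert this

lemma marg_one {ι α : Type} [Fintype ι] [DecidableEq ι] [Fintype α] (w : ι → α → ℝ)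
    (hw : ∀ i, ∑ a, w i a = 1) (i : ι) (g : α → ℝ) :
    ∑ c : ι → α, (∏ j, w j (c j)) * g (c i) = ∑ a, w i a * g a := by
  have := marg w i (hw i) (fun _ => 1) (fun _ _ => rfl) g
  simp only [mul_one] at this
  rw [this, sum_pi_one w hw, one_mul]

lemma second_moment {Z : Type} [Fintype Z] (p : Z → ℝ) (hp : ∑ z, p z = 1) (g : Z → ℝ)
    (hg : ∑ z, p z * g z = 0) (n : ℕ) :
    ∑ z : Fin n → Z, (∏ i, p (z i)) * (∑ i, g (z i)) ^ 2 = n * ∑ z, p z * g z ^ 2 := by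
  have h : ∀ z : Fin n → Z, (∏ i, p (z i)) * (∑ i, g (z i)) ^ 2
      = ∑ i, ∑ j, (∏ i, p (z i)) * g (z i) * g (z j) := by
    intro z
    rw [sq, Finset.sum_mul_sum, Finset.mul_sum]
    apply Finset.sum_congr rfl
    intro i _
    rw [Finset.mul_sum]
    apply Finset.sum_congr rfl
    intro j _
    ring
  simp_rw [h]
  rw [Finset.sum_comm]
  have h2 : ∀ i : Fin n, ∑ z : Fin n → Z, ∑ j, (∏ i, p (z i)) * g (z i) * g (z j)
      = ∑ z, p z * g z ^ 2 := by
    intro i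
    rw [Finset.sum_comm, Finset.sum_eq_single i]
    · have := marg_one (fun _ : Fin n => p) (fun _ => hp) i (fun z => g z ^ 2)
      rw [← this]
      apply Finset.sum_congr rfl
      intro z _
      ring
    · intro j _ hj
      have := marg (fun _ : Fin n => p) j hp (fun z => g (z i))
        (fun c v => by rw [Function.update_of_ne hj.symm]) g
      rw [this, hg, mul_zero]
    · simp
  rw [Finset.sum_congr rfl (fun i _ => h2 i)]
  simp

open scoped Classical in
lemma chebyshev {Z : Type} [Fintype Z] (p : Z → ℝ) (hp0 : ∀ z, 0 ≤ p z) (hp : ∑ z, p z = 1)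
    (g : Z → ℝ) (μ : ℝ) (hμ : μ = ∑ z, p z * g z) (γ : ℝ) (hγ : 0 < γ) (n : ℕ) (hn : 0 < n)
    (E : (Fin n → Z) → Prop)
    (hE : ∀ z, 0 < ∏ i, p (z i) → E z → n * γ ≤ |∑ i, g (z i) - n * μ|) :
    ∑ z : Fin n → Z, (∏ i, p (z i)) * (if E z then 1 else 0)
      ≤ (∑ z, p z * (g z - μ) ^ 2) / γ ^ 2 / n := by
  have hnr : (0:ℝ) < n := by exact_mod_cast hn
  have h0 : ∑ z, p z * (g z - μ) = 0 := by
    simp_rw [mul_sub]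
    rw [Finset.sum_sub_distrib, ← Finset.sum_mul, hp, ← hμ]; ring
  have h := second_moment p hp (fun z => g z - μ) h0 n
  have h1 : ∑ z : Fin n → Z, (∏ i, p (z i)) * (if E z then 1 else 0)
      ≤ ∑ z : Fin n → Z, ((∏ i, p (z i)) * (∑ i, (g (z i) - μ)) ^ 2) / (n * γ) ^ 2 := by
    apply Finset.sum_le_sum
    intro z _
    have hpz : 0 ≤ ∏ i, p (z i) := Finset.prod_nonneg (fun i _ => hp0 _)
    rcases hpz.eq_or_lt with h' | h'
    · rw [← h']; simp
    · split_ifs with hz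
      · have := hE z h' hz
        rw [mul_div_assoc]
        apply mul_le_mul_of_nonneg_left _ hpz
        rw [one_le_div (by positivity)]
        rw [Finset.sum_sub_distrib]
        simp only [Finset.sum_const, Finset.card_univ, Fintype.card_fin, nsmul_eq_mul]
        rw [← sq_abs (_ - _)]
        gcongr
      · rw [mul_zero]; positivity
  refine h1.trans ?_
  rw [← Finset.sum_div, h]
  apply le_of_eq
  field_simp

/-- Gibbs inequality -/
lemma gibbs {A : Type} [Fintype A] (p q : A → ℝ) (hp0 : ∀ a, 0 ≤ p a) (hp : ∑ a, p a = 1)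
    (hq0 : ∀ a, 0 ≤ q a) (hq : ∑ a, q a ≤ 1) (hpq : ∀ a, 0 < p a → 0 < q a) :
    ∑ a, p a * Real.log (q a) ≤ ∑ a, p a * Real.log (p a) := by
  have : ∀ a, p a * Real.log (q a) - p a * Real.log (p a) ≤ q a - p a := by
    intro a
    rcases (hp0 a).eq_or_lt with h | h
    · rw [← h]; simp [hq0 a]
    · have hq' := hpq a h
      rw [← mul_sub, ← Real.log_div hq'.ne' h.ne']
      have := Real.log_le_sub_one_of_pos (div_pos hq' h)
      calc p a * Real.log (q a / p a) ≤ p a * (q a / p a - 1) := by gcongr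
        _ = q a - p a := by field_simp
  have h2 := Finset.sum_le_sum (fun a (_ : a ∈ Finset.univ) => this a)
  rw [Finset.sum_sub_distrib, Finset.sum_sub_distrib] at h2
  linarith


lemma exists_le_avg {A : Type} [Fintype A] (p f : A → ℝ) (hp0 : ∀ a, 0 ≤ p a)
    (hp : ∑ a, p a = 1) (B : ℝ) (h : ∑ a, p a * f a ≤ B) : ∃ a, f a ≤ B := by
  by_contra hcon
  push Not at hcon
  obtain ⟨a, _, ha⟩ : ∃ a ∈ Finset.univ, 0 < p a := by
    by_contra h'
    push Not at h'
    have := Finset.sum_nonpos h'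
    linarith
  have : ∑ a, p a * B < ∑ a, p a * f a := by
    apply Finset.sum_lt_sum
    · intro i _
      exact mul_le_mul_of_nonneg_left (hcon i).le (hp0 i)
    · exact ⟨a, Finset.mem_univ a, mul_lt_mul_of_pos_left (hcon a) ha⟩
  rw [← Finset.sum_mul, hp] at this
  linarith

lemma cover_bound (p q t : ℝ) (L : ℕ) (hp0 : 0 ≤ p) (hp1 : p ≤ 1)
    (hq1 : q ≤ 1) (hq : t * p ≤ q) : (1 - q) ^ L ≤ 1 - p + Real.exp (-(L * t)) := by
  have h1 : 1 - q ≤ Real.exp (-(t * p)) := by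
    have := Real.add_one_le_exp (-(t * p))
    linarith
  have h2 : (1 - q) ^ L ≤ Real.exp (p * (-(L * t))) := by
    calc (1 - q) ^ L ≤ (Real.exp (-(t * p))) ^ L := by gcongr
      _ = Real.exp (p * (-(L * t))) := by rw [← Real.exp_nat_mul]; congr 1; ring
  have h3 := convexOn_exp.2 (Set.mem_univ (0:ℝ)) (Set.mem_univ (-(L * t)))
    (by linarith : 0 ≤ 1 - p) hp0 (by ring)
  simp only [smul_eq_mul, mul_zero, zero_add, Real.exp_zero, mul_one] at h3
  have h4 : p * Real.exp (-(L * t)) ≤ 1 * Real.exp (-(L * t)) := by gcongr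
  linarith

open scoped Classical in
lemma codebook {S V Y Θ : Type} [Fintype S] [Fintype V] [Fintype Y] [Fintype Θ]
    (PS : S → ℝ) (hPS0 : ∀ s, 0 ≤ PS s) (hPS : ∑ s, PS s = 1)
    (PV : V → ℝ) (hPV0 : ∀ s, 0 ≤ PV s) (hPV : ∑ s, PV s = 1)
    (T : Θ → S → V → Y → ℝ) (hT0 : ∀ θ s v y, 0 ≤ T θ s v y) (hT : ∀ θ s v, ∑ y, T θ s v y = 1)
    (A : S → V → Prop) (B : Θ → V → Y → Prop) (β η κ : ℝ) (hη : 0 ≤ η)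
    (M L : ℕ) (hM : 0 < M) (hL : 0 < L)
    (hB : ∀ θ y, ∑ v, PV v * (if B θ v y then 1 else 0) ≤ β)
    (hA : ∀ s v, A s v → ∑ θ, ∑ y, T θ s v y * (if B θ v y then 0 else 1) ≤ η)
    (hκ : ∑ s, PS s * (∑ v, PV v * (if A s v then 0 else 1)) ^ L ≤ κ) :
    ∃ (u : Fin M → S → V) (ψ : Y → Fin M),
      ∑ m, ∑ s, PS s * ∑ θ, ∑ y, T θ s (u m s) y * (if ψ y ≠ m then 1 else 0)
        ≤ M * (Fintype.card Θ * κ + η + M * L * Fintype.card Θ * (β * Fintype.card Θ)) := by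
  let sel : (Fin L → V) → S → V := fun c s =>
    if h : ∃ l, A s (c l) then c h.choose else c ⟨0, hL⟩
  let pass : (Fin M → Fin L → V) → Fin M → Y → Prop := fun c m y => ∃ l θ, B θ (c m l) y
  let ψ : (Fin M → Fin L → V) → Y → Fin M := fun c y =>
    if h : ∃ m, pass c m y then h.choose else ⟨0, hM⟩
  let w : (Fin L → V) → ℝ := fun u => ∏ l, PV (u l)
  have hw0 : ∀ u, 0 ≤ w u := fun u => Finset.prod_nonneg (fun _ _ => hPV0 _)
  have hw1 : ∑ u, w u = 1 := sum_pi_one (fun _ => PV) (fun _ => hPV)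
  let pw : (Fin M → Fin L → V) → ℝ := fun c => ∏ m, w (c m)
  have hpw0 : ∀ c, 0 ≤ pw c := fun u => Finset.prod_nonneg (fun _ _ => hw0 _)
  have hpw1 : ∑ c, pw c = 1 := sum_pi_one (fun _ => w) (fun _ => hw1)
  let J : (Fin M → Fin L → V) → Fin M → (Fin M × Fin L × Θ) → Y → ℝ := fun c m q y =>
    if q.1 = m then 0 else if B q.2.2 (c q.1 q.2.1) y then 1 else 0
  have hJ0 : ∀ c m q y, 0 ≤ J c m q y := by
    intro c m q y; simp only [J]; split_ifs <;> simp
  have hcorrect : ∀ c m y, pass c m y → (∀ m', m' ≠ m → ¬ pass c m' y) → ψ c y = m := by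
    intro c m y h h'
    have hex : ∃ m, pass c m y := ⟨m, h⟩
    have : ψ c y = hex.choose := by simp only [ψ]; rw [dif_pos hex]
    rw [this]
    by_contra hne
    exact h' _ hne hex.choose_spec
  have hJ1 : ∀ c m y m', m' ≠ m → pass c m' y → 1 ≤ ∑ q, J c m q y := by
    rintro c m y m' hne ⟨l, θ, hb⟩
    have : J c m (m', l, θ) y = 1 := by simp [J, hne, hb]
    rw [← this]
    exact Finset.single_le_sum (f := fun q => J c m q y) (fun q _ => hJ0 c m q y)
      (Finset.mem_univ (m', l, θ))
  have hpt : ∀ c m s, ∑ θ, ∑ y, T θ s (sel (c m) s) y * (if ψ c y ≠ m then 1 else 0)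
      ≤ Fintype.card Θ * (∏ l, (if A s (c m l) then (0:ℝ) else 1)) + η
        + ∑ t : Θ × Y, T t.1 s (sel (c m) s) t.2 * ∑ q, J c m q t.2 := by
    intro c m s
    have hthird : 0 ≤ ∑ t : Θ × Y, T t.1 s (sel (c m) s) t.2 * ∑ q, J c m q t.2 :=
      Finset.sum_nonneg (fun t _ => mul_nonneg (hT0 _ _ _ _)
        (Finset.sum_nonneg (fun q _ => hJ0 _ _ _ _)))
    by_cases h : ∃ l, A s (c m l)
    · have hs : sel (c m) s = c m h.choose := by simp only [sel]; rw [dif_pos h]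
      have hgood : A s (sel (c m) s) := by rw [hs]; exact h.choose_spec
      have h2 := hA s _ hgood
      have hprod : 0 ≤ Fintype.card Θ * (∏ l, (if A s (c m l) then (0:ℝ) else 1)) := by
        apply mul_nonneg (by positivity)
        exact Finset.prod_nonneg (fun l _ => by split_ifs <;> simp)
      have h3 : ∑ θ, ∑ y, T θ s (sel (c m) s) y * (if ψ c y ≠ m then 1 else 0)
         ≤ ∑ θ, ∑ y, (T θ s (sel (c m) s) y * (if B θ (sel (c m) s) y then 0 else 1)
           + T θ s (sel (c m) s) y * ∑ q, J c m q y) := by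
        apply Finset.sum_le_sum
        intro θ _
        apply Finset.sum_le_sum
        intro y _
        rw [← mul_add]
        apply mul_le_mul_of_nonneg_left _ (hT0 _ _ _ _)
        have hJs : 0 ≤ ∑ q, J c m q y := Finset.sum_nonneg (fun q _ => hJ0 _ _ _ _)
        by_cases hb : B θ (sel (c m) s) y
        · by_cases ho : ∃ m', m' ≠ m ∧ pass c m' y
          · obtain ⟨m', h1, h2⟩ := ho
            have := hJ1 c m y m' h1 h2
            split_ifs <;> linarith
          · push Not at ho
            have : ψ c y = m := hcorrect c m y ⟨h.choose, θ, by rw [← hs]; exact hb⟩ ho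
            rw [if_neg (by simp [this])]
            split_ifs; linarith
        · rw [if_neg hb]
          split_ifs <;> linarith
      simp_rw [Finset.sum_add_distrib] at h3
      rw [Fintype.sum_prod_type]
      linarith
    · push Not at h
      have : (∏ l, (if A s (c m l) then (0:ℝ) else 1)) = 1 := by
        apply Finset.prod_eq_one
        intro l _
        rw [if_neg (h l)]
      rw [this]
      have h3 : ∑ θ, ∑ y, T θ s (sel (c m) s) y * (if ψ c y ≠ m then 1 else 0)
         ≤ ∑ θ : Θ, (1:ℝ) := by
        apply Finset.sum_le_sum
        intro θ _
        refine le_trans (Finset.sum_le_sum (fun y _ => ?_)) (hT θ s (sel (c m) s)).le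
        have := hT0 θ s (sel (c m) s) y
        split_ifs <;> simp [this]
      rw [Finset.sum_const, Finset.card_univ, nsmul_eq_mul] at h3
      linarith
  have hterm3 : ∀ m s, ∑ c, pw c * ∑ t : Θ × Y, T t.1 s (sel (c m) s) t.2 * ∑ q, J c m q t.2
      ≤ M * L * Fintype.card Θ * (β * Fintype.card Θ) := by
    intro m s
    have hq : ∀ q, ∑ c, ∑ t : Θ × Y, pw c * T t.1 s (sel (c m) s) t.2 * J c m q t.2
        ≤ β * Fintype.card Θ := by
      intro q
      have hsumT : ∑ t : Θ × Y, ∑ c, pw c * T t.1 s (sel (c m) s) t.2 = Fintype.card Θ := by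
        rw [Finset.sum_comm]
        have : ∀ c, ∑ t : Θ × Y, pw c * T t.1 s (sel (c m) s) t.2 = pw c * Fintype.card Θ := by
          intro c
          rw [← Finset.mul_sum, Fintype.sum_prod_type]
          simp [hT]
        simp_rw [this]
        rw [← Finset.sum_mul, hpw1, one_mul]
      rw [Finset.sum_comm, ← hsumT, Finset.mul_sum]
      apply Finset.sum_le_sum
      intro t _
      have hnn : 0 ≤ ∑ c, pw c * T t.1 s (sel (c m) s) t.2 :=
        Finset.sum_nonneg (fun c _ => mul_nonneg (hpw0 _) (hT0 _ _ _ _))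
      by_cases hqm : q.1 = m
      · have hβ : 0 ≤ β := le_trans (Finset.sum_nonneg (fun v _ => mul_nonneg (hPV0 v)
          (by split_ifs <;> simp))) (hB q.2.2 t.2)
        simp only [J, hqm, if_true, mul_zero, Finset.sum_const_zero]
        positivity
      · have := marg (fun _ : Fin M => w) q.1 hw1 (fun c => T t.1 s (sel (c m) s) t.2)
          (fun c v => by rw [Function.update_of_ne (Ne.symm hqm)])
          (fun u => if B q.2.2 (u q.2.1) t.2 then 1 else 0)
        have h2 := marg_one (fun _ : Fin L => PV) (fun _ => hPV) q.2.1
          (fun v => if B q.2.2 v t.2 then 1 else 0)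
        simp only [J, hqm, if_false]
        simp only [pw] at hnn ⊢
        rw [this, mul_comm]
        apply mul_le_mul_of_nonneg_right _ hnn
        simp only [w]
        rw [h2]
        exact hB _ _
    have hre : ∑ c, pw c * ∑ t : Θ × Y, T t.1 s (sel (c m) s) t.2 * ∑ q, J c m q t.2
        = ∑ q, ∑ c, ∑ t : Θ × Y, pw c * T t.1 s (sel (c m) s) t.2 * J c m q t.2 := by
      rw [Finset.sum_comm]
      apply Finset.sum_congr rfl
      intro c _
      rw [Finset.mul_sum, Finset.sum_comm]
      apply Finset.sum_congr rfl
      intro t _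
      rw [Finset.mul_sum, Finset.mul_sum]
      apply Finset.sum_congr rfl
      intro q _
      ring
    rw [hre]
    refine (Finset.sum_le_sum (fun q _ => hq q)).trans ?_
    simp only [Finset.sum_const, Finset.card_univ, Fintype.card_prod, Fintype.card_fin,
      nsmul_eq_mul]
    push_cast
    apply le_of_eq; ring
  have hterm1 : ∀ m s, ∑ c, pw c * (∏ l, (if A s (c m l) then (0:ℝ) else 1))
      = (∑ v, PV v * (if A s v then 0 else 1)) ^ L := by
    intro m s
    have h1 := marg_one (fun _ : Fin M => w) (fun _ => hw1) m
      (fun u => ∏ l, (if A s (u l) then (0:ℝ) else 1))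
    simp only [pw]
    rw [h1]
    simp only [w]
    simp_rw [← Finset.prod_mul_distrib]
    rw [sum_pi_prod (fun _ : Fin L => fun v => PV v * (if A s v then 0 else 1))]
    simp
  have havg : ∑ c, pw c * (∑ m, ∑ s, PS s * ∑ θ, ∑ y, T θ s (sel (c m) s) y *
      (if ψ c y ≠ m then 1 else 0))
      ≤ M * (Fintype.card Θ * κ + η + M * L * Fintype.card Θ * (β * Fintype.card Θ)) := by
    have hm : ∀ m, ∑ s, PS s * ∑ c, pw c * (∑ θ, ∑ y, T θ s (sel (c m) s) y *
        (if ψ c y ≠ m then 1 else 0))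
        ≤ Fintype.card Θ * κ + η + M * L * Fintype.card Θ * (β * Fintype.card Θ) := by
      intro m
      have hs : ∀ s, ∑ c, pw c * (∑ θ, ∑ y, T θ s (sel (c m) s) y *
          (if ψ c y ≠ m then 1 else 0)) ≤
          Fintype.card Θ * (∑ v, PV v * (if A s v then 0 else 1)) ^ L + η
            + M * L * Fintype.card Θ * (β * Fintype.card Θ) := by
        intro s
        refine (Finset.sum_le_sum (fun c _ => mul_le_mul_of_nonneg_left (hpt c m s)
          (hpw0 c))).trans ?_
        simp_rw [mul_add]
        rw [Finset.sum_add_distrib, Finset.sum_add_distrib, ← Finset.sum_mul, hpw1, one_mul]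
        have e1 : ∑ c, pw c * (Fintype.card Θ * (∏ l, (if A s (c m l) then (0:ℝ) else 1)))
            = Fintype.card Θ * (∑ v, PV v * (if A s v then 0 else 1)) ^ L := by
          rw [← hterm1 m s, Finset.mul_sum]
          apply Finset.sum_congr rfl
          intro c _
          ring
        rw [e1]
        linarith [hterm3 m s]
      refine (Finset.sum_le_sum (fun s _ => mul_le_mul_of_nonneg_left (hs s)
          (hPS0 s))).trans ?_
      simp_rw [mul_add]
      rw [Finset.sum_add_distrib, Finset.sum_add_distrib, ← Finset.sum_mul, ← Finset.sum_mul,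
        hPS, one_mul, one_mul]
      have e1 : ∑ s, PS s * (Fintype.card Θ * (∑ v, PV v * (if A s v then 0 else 1)) ^ L)
        = Fintype.card Θ * ∑ s, PS s * (∑ v, PV v * (if A s v then 0 else 1)) ^ L := by
        rw [Finset.mul_sum]
        apply Finset.sum_congr rfl
        intro c _
        ring
      rw [e1]
      have : (Fintype.card Θ : ℝ) * ∑ s, PS s * (∑ v, PV v * (if A s v then 0 else 1)) ^ L
        ≤ Fintype.card Θ * κ := by gcongr
      linarith
    have hre : ∑ c, pw c * (∑ m, ∑ s, PS s * ∑ θ, ∑ y, T θ s (sel (c m) s) y *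
      (if ψ c y ≠ m then 1 else 0)) = ∑ m, ∑ s, PS s * ∑ c, pw c * (∑ θ, ∑ y,
        T θ s (sel (c m) s) y * (if ψ c y ≠ m then 1 else 0)) := by
      simp_rw [Finset.mul_sum (s := (Finset.univ : Finset (Fin M)))]
      rw [Finset.sum_comm]
      apply Finset.sum_congr rfl
      intro m _
      simp_rw [Finset.mul_sum (s := (Finset.univ : Finset S))]
      rw [Finset.sum_comm]
      apply Finset.sum_congr rfl
      intro s _
      rw [Finset.mul_sum (s := (Finset.univ : Finset (Fin M → Fin L → V)))]
      apply Finset.sum_congr rfl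
      intro c _
      ring
    rw [hre]
    refine (Finset.sum_le_sum (fun m _ => hm m)).trans ?_
    rw [Finset.sum_const, Finset.card_univ, nsmul_eq_mul, Fintype.card_fin]
  obtain ⟨c, hc⟩ := exists_le_avg pw _ hpw0 hpw1 _ havg
  exact ⟨fun m s => sel (c m) s, ψ c, hc⟩


open scoped Classical in
lemma oneshot {S V Y Θ : Type} [Fintype S] [Fintype V] [Fintype Y] [Fintype Θ]
    (PS : S → ℝ) (hPS0 : ∀ s, 0 ≤ PS s) (hPS : ∑ s, PS s = 1)
    (Qv : S → V → ℝ) (hQ0 : ∀ s v, 0 ≤ Qv s v) (hQ : ∀ s, ∑ v, Qv s v = 1)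
    (T : Θ → S → V → Y → ℝ) (hT0 : ∀ θ s v y, 0 ≤ T θ s v y) (hT : ∀ θ s v, ∑ y, T θ s v y = 1)
    (PV : V → ℝ) (hPVd : ∀ v, PV v = ∑ s, PS s * Qv s v)
    (pVY : Θ → V → Y → ℝ) (hpVY : ∀ θ v y, pVY θ v y = ∑ s, PS s * Qv s v * T θ s v y)
    (PY : Θ → Y → ℝ) (hPY : ∀ θ y, PY θ y = ∑ v, pVY θ v y)
    (a b δ0 δ1 η : ℝ) (hη : 0 < η)
    (M L : ℕ) (hM : 0 < M) (hL : 0 < L)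
    (hA0 : ∑ s, ∑ v, PS s * Qv s v * (if Qv s v ≤ Real.exp a * PV v then 0 else 1) ≤ δ0)
    (hD : ∑ θ, ∑ s, ∑ v, ∑ y, PS s * Qv s v * T θ s v y *
      (if Real.exp b * (PV v * PY θ y) < pVY θ v y then 0 else 1) ≤ δ1) :
    ∃ (u : Fin M → S → V) (ψ : Y → Fin M),
      ∑ m, ∑ s, PS s * ∑ θ, ∑ y, T θ s (u m s) y * (if ψ y ≠ m then 1 else 0)
        ≤ M * (Fintype.card Θ * (δ0 + δ1 / η + Real.exp (-(L * Real.exp (-a)))) + η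
          + M * L * Fintype.card Θ * (Real.exp (-b) * Fintype.card Θ)) := by
  have hPV0 : ∀ v, 0 ≤ PV v := fun v => by
    rw [hPVd]; exact Finset.sum_nonneg (fun s _ => mul_nonneg (hPS0 _) (hQ0 _ _))
  have hPV : ∑ v, PV v = 1 := by
    simp_rw [hPVd]
    rw [Finset.sum_comm]
    simp_rw [← Finset.mul_sum, hQ, mul_one, hPS]
  have hpVY0 : ∀ θ v y, 0 ≤ pVY θ v y := fun θ v y => by
    rw [hpVY]
    exact Finset.sum_nonneg (fun s _ => mul_nonneg (mul_nonneg (hPS0 _) (hQ0 _ _)) (hT0 _ _ _ _))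
  let D : S → V → ℝ := fun s v => ∑ θ, ∑ y, T θ s v y *
      (if Real.exp b * (PV v * PY θ y) < pVY θ v y then 0 else 1)
  have hD0 : ∀ s v, 0 ≤ D s v := fun s v => Finset.sum_nonneg (fun θ _ =>
    Finset.sum_nonneg (fun y _ => mul_nonneg (hT0 _ _ _ _) (by split_ifs <;> simp)))
  have hDsum : ∑ s, ∑ v, PS s * Qv s v * D s v ≤ δ1 := by
    refine le_trans (le_of_eq ?_) hD
    rw [Finset.sum_comm (s := (Finset.univ : Finset Θ))]
    apply Finset.sum_congr rfl; intro s _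
    rw [Finset.sum_comm (s := (Finset.univ : Finset Θ))]
    apply Finset.sum_congr rfl; intro v _
    simp only [D]
    rw [Finset.mul_sum]
    apply Finset.sum_congr rfl; intro θ _
    rw [Finset.mul_sum]
    apply Finset.sum_congr rfl; intro y _
    ring
  obtain ⟨A, hAd⟩ : ∃ A : S → V → Prop, ∀ s v, A s v ↔ (Qv s v ≤ Real.exp a * PV v ∧ D s v ≤ η) :=
    ⟨_, fun _ _ => Iff.rfl⟩
  apply codebook PS hPS0 hPS PV hPV0 hPV T hT0 hT A
    (fun θ v y => Real.exp b * (PV v * PY θ y) < pVY θ v y) (Real.exp (-b)) η _ hη.le M L hM hL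
  · intro θ y
    have hPY0 : 0 ≤ PY θ y := by rw [hPY]; exact Finset.sum_nonneg (fun v _ => hpVY0 θ v y)
    rcases hPY0.eq_or_lt with h | h
    · have h0 : ∀ v, pVY θ v y = 0 := by
        intro v
        rw [hPY] at h
        exact (Finset.sum_eq_zero_iff_of_nonneg (fun v _ => hpVY0 θ v y)).1 h.symm v
          (Finset.mem_univ v)
      simp only [h0, ← h, mul_zero, lt_irrefl, if_false, Finset.sum_const_zero]
      positivity
    · have : ∀ v, PV v * (if Real.exp b * (PV v * PY θ y) < pVY θ v y then 1 else 0)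
          ≤ Real.exp (-b) / PY θ y * pVY θ v y := by
        intro v
        have hv := hpVY0 θ v y
        split_ifs with hb
        · rw [mul_one, div_mul_eq_mul_div, le_div_iff₀ h, Real.exp_neg,
            ← div_eq_inv_mul, le_div_iff₀ (Real.exp_pos b)]
          linarith
        · rw [mul_zero]; positivity
      refine (Finset.sum_le_sum (fun v _ => this v)).trans ?_
      rw [← Finset.mul_sum, ← hPY]
      apply le_of_eq
      field_simp
  · intro s v h
    exact ((hAd s v).1 h).2
  · have hs : ∀ s, (∑ v, PV v * (if A s v then (0:ℝ) else 1)) ^ L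
        ≤ (∑ v, Qv s v * ((if Qv s v ≤ Real.exp a * PV v then 0 else 1) + D s v / η))
          + Real.exp (-(L * Real.exp (-a))) := by
      intro s
      set G : V → ℝ := fun v => if A s v then (1:ℝ) else 0 with hG
      have hG0 : ∀ v, 0 ≤ G v := fun v => by simp only [hG]; split_ifs <;> simp
      have hG1 : ∀ v, G v ≤ 1 := fun v => by simp only [hG]; split_ifs <;> simp
      have e1 : ∑ v, PV v * (if A s v then (0:ℝ) else 1)
          = 1 - ∑ v, PV v * G v := by
        rw [eq_sub_iff_add_eq, ← Finset.sum_add_distrib]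
        refine Eq.trans (Finset.sum_congr rfl fun v _ => ?_) hPV
        simp only [hG]
        split_ifs <;> simp
      rw [e1]
      have hp0 : 0 ≤ ∑ v, Qv s v * G v :=
        Finset.sum_nonneg (fun v _ => mul_nonneg (hQ0 _ _) (hG0 v))
      have hp1 : ∑ v, Qv s v * G v ≤ 1 := by
        rw [← hQ s]
        exact Finset.sum_le_sum (fun v _ => mul_le_of_le_one_right (hQ0 _ _) (hG1 v))
      have hq1 : ∑ v, PV v * G v ≤ 1 := by
        rw [← hPV]
        exact Finset.sum_le_sum (fun v _ => mul_le_of_le_one_right (hPV0 _) (hG1 v))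
      have hq : Real.exp (-a) * ∑ v, Qv s v * G v ≤ ∑ v, PV v * G v := by
        rw [Finset.mul_sum]
        apply Finset.sum_le_sum; intro v _
        simp only [hG]
        split_ifs with h
        · rw [Real.exp_neg, mul_one, mul_one, ← div_eq_inv_mul, div_le_iff₀ (Real.exp_pos a)]
          linarith [((hAd s v).1 h).1]
        · simp
      have hc := cover_bound _ _ _ L hp0 hp1 hq1 hq
      have e2 : 1 - ∑ v, Qv s v * G v ≤
          ∑ v, Qv s v * ((if Qv s v ≤ Real.exp a * PV v then 0 else 1) + D s v / η) := by
        refine le_trans (b := ∑ v, (Qv s v - Qv s v * G v)) ?_ (Finset.sum_le_sum fun v _ => ?_)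
        · rw [Finset.sum_sub_distrib, hQ s]
        rw [show Qv s v - Qv s v * G v = Qv s v * (1 - G v) by ring]
        apply mul_le_mul_of_nonneg_left _ (hQ0 _ _)
        have hdn : 0 ≤ D s v / η := div_nonneg (hD0 _ _) hη.le
        simp only [hG]
        by_cases h1 : Qv s v ≤ Real.exp a * PV v
        · by_cases h2 : D s v ≤ η
          · simp [hAd, h1, h2, hdn]
          · have : 1 ≤ D s v / η := by rw [one_le_div hη]; linarith
            simp [hAd, h1, h2, this]
        · simp [hAd, h1, hdn]
      linarith
    refine (Finset.sum_le_sum (fun s _ => mul_le_mul_of_nonneg_left (hs s) (hPS0 s))).trans ?_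
    simp_rw [mul_add, Finset.sum_add_distrib, mul_add, Finset.sum_add_distrib]
    rw [← Finset.sum_mul, hPS, one_mul]
    have e3 : ∑ s, PS s * ∑ v, Qv s v * (if Qv s v ≤ Real.exp a * PV v then 0 else 1) ≤ δ0 := by
      refine le_trans (le_of_eq ?_) hA0
      simp_rw [Finset.mul_sum, mul_assoc]
    have e4 : ∑ s, PS s * ∑ v, Qv s v * (D s v / η) ≤ δ1 / η := by
      rw [le_div_iff₀ hη]
      refine le_trans (le_of_eq ?_) hDsum
      rw [Finset.sum_mul]
      apply Finset.sum_congr rfl; intro s _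
      rw [Finset.mul_sum, Finset.sum_mul]
      apply Finset.sum_congr rfl; intro v _
      field_simp
    linarith


lemma sum_arrow2 {A B : Type} [Fintype A] [Fintype B] (n : ℕ)
    (F : (Fin n → A) → (Fin n → B) → ℝ) :
    ∑ s, ∑ v, F s v = ∑ z : Fin n → A × B, F (fun i => (z i).1) (fun i => (z i).2) := by
  rw [← Fintype.sum_prod_type']
  rw [← Equiv.sum_comp (Equiv.arrowProdEquivProdArrow (Fin n) (fun _ => A) (fun _ => B))]
  rfl

open scoped Classical in
lemma nletter {S V X Y Θ : Type} [Fintype S] [Fintype V] [Fintype X] [Fintype Y] [Fintype Θ]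
    (PS : S → ℝ) (hPS0 : ∀ s, 0 ≤ PS s) (hPS : ∑ s, PS s = 1)
    (Qv : S → V → ℝ) (hQ0 : ∀ s v, 0 ≤ Qv s v) (hQ : ∀ s, ∑ v, Qv s v = 1)
    (Qx : S → V → X → ℝ) (hx0 : ∀ s v x, 0 ≤ Qx s v x) (hx : ∀ s v, ∑ x, Qx s v x = 1)
    (W : Θ → X → S → Y → ℝ) (hW0 : ∀ θ x s y, 0 ≤ W θ x s y) (hW : ∀ θ x s, ∑ y, W θ x s y = 1)
    (PV : V → ℝ) (hPVd : ∀ v, PV v = ∑ s, PS s * Qv s v)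
    (pVY : Θ → V → Y → ℝ)
    (hpVY : ∀ θ v y, pVY θ v y = ∑ s, PS s * Qv s v * ∑ x, Qx s v x * W θ x s y)
    (PY : Θ → Y → ℝ) (hPY : ∀ θ y, PY θ y = ∑ v, pVY θ v y)
    (IS IY g : ℝ) (hg : 0 < g) (hIS : IS = ∑ s, ∑ v, PS s * Qv s v * Real.log (Qv s v / PV v))
    (hIY : ∀ θ, IY ≤ ∑ v, ∑ y, pVY θ v y * Real.log (pVY θ v y / (PV v * PY θ y))) :
    ∃ C : ℝ, ∀ (n M L : ℕ) (η : ℝ), 0 < n → 0 < M → 0 < L → 0 < η →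
    ∃ (φ : Fin M → (Fin n → S) → (Fin n → X)) (ψ : (Fin n → Y) → Fin M),
      ∑ m, ∑ θ, ∑ s : Fin n → S, (∏ i, PS (s i)) * ∑ y : Fin n → Y,
          (∏ i, W θ (φ m s i) (s i) (y i)) * (if ψ y ≠ m then 1 else 0)
        ≤ M * (Fintype.card Θ * (C / n + C / n / η +
            Real.exp (-(L * Real.exp (-(n * (IS + g)))))) + η
          + M * L * Fintype.card Θ * (Real.exp (-(n * (IY - g))) * Fintype.card Θ)) := by
  let t : Θ → S → V → Y → ℝ := fun θ s v y => ∑ x, Qx s v x * W θ x s y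
  have ht0 : ∀ θ s v y, 0 ≤ t θ s v y := fun θ s v y =>
    Finset.sum_nonneg (fun x _ => mul_nonneg (hx0 _ _ _) (hW0 _ _ _ _))
  have ht : ∀ θ s v, ∑ y, t θ s v y = 1 := by
    intro θ s v
    simp only [t]
    rw [Finset.sum_comm]
    simp_rw [← Finset.mul_sum, hW, mul_one, hx]
  have hPV0 : ∀ v, 0 ≤ PV v := fun v => by
    rw [hPVd]; exact Finset.sum_nonneg (fun s _ => mul_nonneg (hPS0 _) (hQ0 _ _))
  have hpVY0 : ∀ θ v y, 0 ≤ pVY θ v y := fun θ v y => by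
    rw [hpVY]
    exact Finset.sum_nonneg (fun s _ => mul_nonneg (mul_nonneg (hPS0 _) (hQ0 _ _)) (ht0 θ s v y))
  let p0 : S × V → ℝ := fun z => PS z.1 * Qv z.1 z.2
  have hp00 : ∀ z, 0 ≤ p0 z := fun z => mul_nonneg (hPS0 _) (hQ0 _ _)
  have hp01 : ∑ z, p0 z = 1 := by
    rw [Fintype.sum_prod_type]
    simp only [p0]
    simp_rw [← Finset.mul_sum, hQ, mul_one, hPS]
  let p1 : Θ → S × V × Y → ℝ := fun θ z => PS z.1 * Qv z.1 z.2.1 * t θ z.1 z.2.1 z.2.2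
  have hp10 : ∀ θ z, 0 ≤ p1 θ z := fun θ z =>
    mul_nonneg (mul_nonneg (hPS0 _) (hQ0 _ _)) (ht0 _ _ _ _)
  have hp11 : ∀ θ, ∑ z, p1 θ z = 1 := by
    intro θ
    rw [Fintype.sum_prod_type]
    simp_rw [Fintype.sum_prod_type]
    simp only [p1]
    simp_rw [← Finset.mul_sum, ht, mul_one, ← Finset.mul_sum, hQ, mul_one, hPS]
  let g0 : S × V → ℝ := fun z => Real.log (Qv z.1 z.2 / PV z.2)
  let g1 : Θ → S × V × Y → ℝ := fun θ z =>
    Real.log (pVY θ z.2.1 z.2.2 / (PV z.2.1 * PY θ z.2.2))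
  let I1 : Θ → ℝ := fun θ => ∑ v, ∑ y, pVY θ v y * Real.log (pVY θ v y / (PV v * PY θ y))
  have hμ0 : IS = ∑ z, p0 z * g0 z := by
    rw [hIS, Fintype.sum_prod_type]
  have hμ1 : ∀ θ, I1 θ = ∑ z, p1 θ z * g1 θ z := by
    intro θ
    rw [Fintype.sum_prod_type, Finset.sum_comm, Fintype.sum_prod_type]
    apply Finset.sum_congr rfl; intro v _
    apply Finset.sum_congr rfl; intro y _
    simp only [p1, g1]
    rw [← Finset.sum_mul, hpVY]
  -- positivity facts
  have hpos0 : ∀ z, 0 < p0 z → 0 < Qv z.1 z.2 ∧ 0 < PV z.2 := by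
    intro z hz
    refine ⟨pos_of_mul_pos_right hz (hPS0 _), ?_⟩
    rw [hPVd]
    exact lt_of_lt_of_le hz (Finset.single_le_sum (f := fun s => PS s * Qv s z.2)
      (fun s _ => mul_nonneg (hPS0 _) (hQ0 _ _)) (Finset.mem_univ z.1))
  have hpos1 : ∀ θ z, 0 < p1 θ z → 0 < pVY θ z.2.1 z.2.2 ∧ 0 < PV z.2.1 ∧ 0 < PY θ z.2.2 := by
    intro θ z hz
    have h1 : 0 < pVY θ z.2.1 z.2.2 := by
      rw [hpVY]
      exact lt_of_lt_of_le hz (Finset.single_le_sum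
        (f := fun s => PS s * Qv s z.2.1 * t θ s z.2.1 z.2.2)
        (fun s _ => mul_nonneg (mul_nonneg (hPS0 _) (hQ0 _ _)) (ht0 _ _ _ _))
        (Finset.mem_univ z.1))
    refine ⟨h1, (hpos0 (z.1, z.2.1) (pos_of_mul_pos_left hz (ht0 _ _ _ _))).2, ?_⟩
    rw [hPY]
    exact lt_of_lt_of_le h1 (Finset.single_le_sum (f := fun v => pVY θ v z.2.2)
      (fun v _ => hpVY0 _ _ _) (Finset.mem_univ z.2.1))
  have hpp : ∀ {Z : Type} (p : Z → ℝ) (_ : ∀ z, 0 ≤ p z) (n : ℕ) (z : Fin n → Z),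
      0 < ∏ i, p (z i) → ∀ i, 0 < p (z i) := by
    intro Z p hp n z h i
    rcases (hp (z i)).eq_or_lt with h' | h'
    · rw [Finset.prod_eq_zero (Finset.mem_univ i) h'.symm] at h
      exact absurd h (lt_irrefl 0)
    · exact h'
  let C0 : ℝ := (∑ z, p0 z * (g0 z - IS) ^ 2) / g ^ 2
  let C1 : ℝ := ∑ θ, (∑ z, p1 θ z * (g1 θ z - I1 θ) ^ 2) / g ^ 2
  refine ⟨max C0 C1, ?_⟩
  intro n M L η hn hM hL hη
  have hnr : (0:ℝ) < n := by exact_mod_cast hn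
  have hone := oneshot (S := Fin n → S) (V := Fin n → V) (Y := Fin n → Y) (Θ := Θ)
    (fun s => ∏ i, PS (s i)) (fun s => Finset.prod_nonneg (fun i _ => hPS0 _))
    (sum_pi_one (fun _ => PS) (fun _ => hPS))
    (fun s v => ∏ i, Qv (s i) (v i)) (fun s v => Finset.prod_nonneg (fun i _ => hQ0 _ _))
    (fun s => sum_pi_one (fun i => Qv (s i)) (fun i => hQ _))
    (fun θ s v y => ∏ i, t θ (s i) (v i) (y i))
    (fun θ s v y => Finset.prod_nonneg (fun i _ => ht0 _ _ _ _))
    (fun θ s v => sum_pi_one (fun i => t θ (s i) (v i)) (fun i => ht _ _ _))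
    (fun v => ∏ i, PV (v i))
    (by
      intro v
      simp_rw [← Finset.prod_mul_distrib]
      rw [sum_pi_prod (fun i s => PS s * Qv s (v i))]
      simp_rw [hPVd])
    (fun θ v y => ∏ i, pVY θ (v i) (y i))
    (by
      intro θ v y
      simp_rw [← Finset.prod_mul_distrib]
      rw [sum_pi_prod (fun i s => PS s * Qv s (v i) * t θ s (v i) (y i))]
      simp_rw [hpVY, t])
    (fun θ y => ∏ i, PY θ (y i))
    (by
      intro θ y
      rw [sum_pi_prod (fun i v => pVY θ v (y i))]
      simp_rw [hPY])
    (n * (IS + g)) (n * (IY - g)) (max C0 C1 / n) (max C0 C1 / n) η hη M L hM hL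
    (by
      have hch := chebyshev p0 hp00 hp01 g0 IS hμ0 g hg n hn
        (fun z => ¬ (∏ i, Qv (z i).1 (z i).2 ≤ Real.exp (n * (IS + g)) * ∏ i, PV (z i).2))
        (by
          intro z hz hE
          push Not at hE
          have hzi := hpp p0 hp00 n z hz
          have hl := Real.log_lt_log (mul_pos (Real.exp_pos _)
            (Finset.prod_pos (fun i _ => (hpos0 _ (hzi i)).2))) hE
          rw [Real.log_mul (Real.exp_pos _).ne'
            (Finset.prod_pos (fun i _ => (hpos0 _ (hzi i)).2)).ne', Real.log_exp,
            Real.log_prod (fun i _ => (hpos0 _ (hzi i)).2.ne'),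
            Real.log_prod (fun i _ => (hpos0 _ (hzi i)).1.ne')] at hl
          have hs : ∑ i, g0 (z i) = ∑ i, Real.log (Qv (z i).1 (z i).2)
              - ∑ i, Real.log (PV (z i).2) := by
            rw [← Finset.sum_sub_distrib]
            apply Finset.sum_congr rfl; intro i _
            simp only [g0]
            rw [Real.log_div (hpos0 _ (hzi i)).1.ne' (hpos0 _ (hzi i)).2.ne']
          refine le_trans ?_ (le_abs_self _)
          rw [hs]; linarith)
      rw [sum_arrow2]
      refine le_trans (le_of_eq ?_) (hch.trans ?_)
      · apply Finset.sum_congr rfl; intro z _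
        simp only [p0, Finset.prod_mul_distrib]
        congr 1
        split_ifs <;> first | rfl | contradiction
      · exact div_le_div_of_nonneg_right (le_max_left C0 C1) hnr.le)
    (by
      have hch : ∀ θ, ∑ s : Fin n → S, ∑ v : Fin n → V, ∑ y : Fin n → Y,
          (∏ i, PS (s i)) * (∏ i, Qv (s i) (v i)) * (∏ i, t θ (s i) (v i) (y i)) *
          (if Real.exp (n * (IY - g)) * ((∏ i, PV (v i)) * (∏ i, PY θ (y i)))
            < ∏ i, pVY θ (v i) (y i) then 0 else 1) ≤
          (∑ z, p1 θ z * (g1 θ z - I1 θ) ^ 2) / g ^ 2 / n := by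
        intro θ
        have hch := chebyshev (p1 θ) (hp10 θ) (hp11 θ) (g1 θ) (I1 θ) (hμ1 θ) g hg n hn
          (fun z => ¬ (Real.exp (n * (IY - g)) * ((∏ i, PV (z i).2.1) * (∏ i, PY θ (z i).2.2))
            < ∏ i, pVY θ (z i).2.1 (z i).2.2))
          (by
            intro z hz hE
            push Not at hE
            have hzi := hpp (p1 θ) (hp10 θ) n z hz
            have q1 : ∀ i, 0 < pVY θ (z i).2.1 (z i).2.2 := fun i => (hpos1 θ _ (hzi i)).1
            have q2 : ∀ i, 0 < PV (z i).2.1 := fun i => (hpos1 θ _ (hzi i)).2.1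
            have q3 : ∀ i, 0 < PY θ (z i).2.2 := fun i => (hpos1 θ _ (hzi i)).2.2
            have r2 := Finset.prod_pos (fun i (_ : i ∈ Finset.univ) => q2 i)
            have r3 := Finset.prod_pos (fun i (_ : i ∈ Finset.univ) => q3 i)
            have hl := Real.log_le_log (Finset.prod_pos (fun i (_ : i ∈ Finset.univ) => q1 i)) hE
            rw [Real.log_mul (Real.exp_pos _).ne' (mul_pos r2 r3).ne', Real.log_exp,
              Real.log_mul r2.ne' r3.ne',
              Real.log_prod (fun i _ => (q1 i).ne'),
              Real.log_prod (fun i _ => (q2 i).ne'),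
              Real.log_prod (fun i _ => (q3 i).ne')] at hl
            have hs : ∑ i, g1 θ (z i) = ∑ i, Real.log (pVY θ (z i).2.1 (z i).2.2)
                - (∑ i, Real.log (PV (z i).2.1) + ∑ i, Real.log (PY θ (z i).2.2)) := by
              rw [← Finset.sum_add_distrib, ← Finset.sum_sub_distrib]
              apply Finset.sum_congr rfl; intro i _
              simp only [g1]
              rw [Real.log_div (q1 i).ne' (mul_pos (q2 i) (q3 i)).ne',
                Real.log_mul (q2 i).ne' (q3 i).ne']
            refine le_trans ?_ (neg_le_abs _)
            have hI : (n:ℝ) * IY ≤ n * I1 θ := mul_le_mul_of_nonneg_left (hIY θ) hnr.le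
            rw [hs]; linarith)
        simp_rw [sum_arrow2 (A := V) (B := Y)]
        rw [sum_arrow2]
        refine le_trans (le_of_eq ?_) hch
        apply Finset.sum_congr rfl; intro z _
        simp only [p1, Finset.prod_mul_distrib]
        congr 1
        split_ifs <;> first | rfl | contradiction
      refine (Finset.sum_le_sum (fun θ _ => hch θ)).trans ?_
      rw [← Finset.sum_div]
      exact div_le_div_of_nonneg_right (le_max_right C0 C1) hnr.le)
  obtain ⟨u, ψ, h⟩ := hone
  have hsel : ∀ (m : Fin M) (s : Fin n → S), ∃ x : Fin n → X,
      ∑ θ, ∑ y : Fin n → Y, (∏ i, W θ (x i) (s i) (y i)) * (if ψ y ≠ m then 1 else 0)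
      ≤ ∑ θ, ∑ y, (∏ i, t θ (s i) (u m s i) (y i)) * (if ψ y ≠ m then 1 else 0) := by
    intro m s
    apply exists_le_avg (fun x : Fin n → X => ∏ i, Qx (s i) (u m s i) (x i))
      _ (fun x => Finset.prod_nonneg (fun i _ => hx0 _ _ _))
      (sum_pi_one (fun i => Qx (s i) (u m s i)) (fun i => hx _ _))
    apply le_of_eq
    simp_rw [Finset.mul_sum]
    rw [Finset.sum_comm]
    apply Finset.sum_congr rfl; intro θ _
    rw [Finset.sum_comm]
    apply Finset.sum_congr rfl; intro y _
    simp only [t]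
    rw [← sum_pi_prod (fun i x => Qx (s i) (u m s i) x * W θ x (s i) (y i)), Finset.sum_mul]
    apply Finset.sum_congr rfl; intro x _
    rw [Finset.prod_mul_distrib]
    ring
  choose φ hφ using hsel
  refine ⟨φ, ψ, le_trans ?_ h⟩
  apply Finset.sum_le_sum; intro m _
  rw [Finset.sum_comm]
  apply Finset.sum_le_sum; intro s _
  rw [← Finset.mul_sum]
  exact mul_le_mul_of_nonneg_left (hφ m s) (Finset.prod_nonneg (fun i _ => hPS0 _))


lemma expurgate (M : ℕ) (e : Fin (2 * M) → ℝ) (he0 : ∀ m, 0 ≤ e m) (δ : ℝ) (hδ : 0 < δ)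
    (h : ∑ m, e m ≤ 2 * M * δ) :
    ∃ ι : Fin M → Fin (2 * M), Function.Injective ι ∧ ∀ m, e (ι m) ≤ 2 * δ := by
  let good := Finset.univ.filter (fun m => e m ≤ 2 * δ)
  let bad := Finset.univ.filter (fun m => ¬ e m ≤ 2 * δ)
  have hc : good.card + bad.card = 2 * M := by
    have := Finset.card_filter_add_card_filter_not (s := (Finset.univ : Finset (Fin (2 * M))))
      (fun m => e m ≤ 2 * δ)
    rw [Finset.card_univ, Fintype.card_fin] at this
    exact this
  have hb : (bad.card : ℝ) * (2 * δ) ≤ 2 * M * δ := by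
    refine le_trans ?_ h
    calc (bad.card : ℝ) * (2 * δ) = ∑ m ∈ bad, 2 * δ := by simp
      _ ≤ ∑ m ∈ bad, e m := Finset.sum_le_sum (fun m hm => by
          have := (Finset.mem_filter.1 hm).2
          linarith)
      _ ≤ ∑ m, e m := Finset.sum_le_sum_of_subset_of_nonneg (Finset.subset_univ _)
          (fun m _ _ => he0 m)
  have hb2 : (bad.card : ℝ) ≤ M := by
    have : (bad.card : ℝ) * (2 * δ) ≤ M * (2 * δ) := by linarith
    exact le_of_mul_le_mul_right this (by positivity)
  have hb3 : bad.card ≤ M := by exact_mod_cast hb2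
  have hg : M ≤ good.card := by omega
  refine ⟨good.orderEmbOfCardLe hg, (good.orderEmbOfCardLe hg).injective, fun m => ?_⟩
  exact (Finset.mem_filter.1 (good.orderEmbOfCardLe_mem hg m)).2

open Filter Topology in
lemma err_tendsto (c C η g : ℝ) (hg : 0 < g) :
    Tendsto (fun n : ℕ => c * (C / n + C / n / η + Real.exp (-(Real.exp (n * g))))
      + 8 * c * c * Real.exp (-(2 * (n * g)))) atTop (𝓝 0) := by
  have h1 : Tendsto (fun n : ℕ => C / (n:ℝ)) atTop (𝓝 0) := tendsto_const_div_atTop_nhds_zero_nat C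
  have h2 : Tendsto (fun n : ℕ => C / (n:ℝ) / η) atTop (𝓝 0) := by
    have := h1.div_const η
    simpa using this
  have h3 : Tendsto (fun n : ℕ => (n:ℝ) * g) atTop atTop :=
    tendsto_natCast_atTop_atTop.atTop_mul_const hg
  have h4 : Tendsto (fun n : ℕ => Real.exp (-(Real.exp (n * g)))) atTop (𝓝 0) :=
    Real.tendsto_exp_neg_atTop_nhds_zero.comp (Real.tendsto_exp_atTop.comp h3)
  have h5 : Tendsto (fun n : ℕ => Real.exp (-(2 * (n * g)))) atTop (𝓝 0) :=
    Real.tendsto_exp_neg_atTop_nhds_zero.comp (h3.const_mul_atTop (by norm_num : (0:ℝ) < 2))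
  have := (((h1.add h2).add h4).const_mul c).add (h5.const_mul (8 * c * c))
  simpa using this

lemma ceil_exp_bounds (x : ℝ) (hx : 0 ≤ x) :
    0 < ⌈Real.exp x⌉₊ ∧ Real.exp x ≤ (⌈Real.exp x⌉₊ : ℝ) ∧ (⌈Real.exp x⌉₊ : ℝ) ≤ 2 * Real.exp x := by
  refine ⟨Nat.ceil_pos.2 (Real.exp_pos x), Nat.le_ceil _, ?_⟩
  have := Nat.ceil_lt_add_one (Real.exp_pos x).le
  have h1 : 1 ≤ Real.exp x := Real.one_le_exp hx
  linarith

open scoped Classical in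
lemma ach {S V X Y Θ : Type} [Fintype S] [Fintype V] [Fintype X] [Fintype Y] [Fintype Θ]
    (PS : S → ℝ) (hPS0 : ∀ s, 0 ≤ PS s) (hPS : ∑ s, PS s = 1)
    (Qv : S → V → ℝ) (hQ0 : ∀ s v, 0 ≤ Qv s v) (hQ : ∀ s, ∑ v, Qv s v = 1)
    (Qx : S → V → X → ℝ) (hx0 : ∀ s v x, 0 ≤ Qx s v x) (hx : ∀ s v, ∑ x, Qx s v x = 1)
    (W : Θ → X → S → Y → ℝ) (hW0 : ∀ θ x s y, 0 ≤ W θ x s y) (hW : ∀ θ x s, ∑ y, W θ x s y = 1)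
    (PV : V → ℝ) (hPVd : ∀ v, PV v = ∑ s, PS s * Qv s v)
    (pVY : Θ → V → Y → ℝ)
    (hpVY : ∀ θ v y, pVY θ v y = ∑ s, PS s * Qv s v * ∑ x, Qx s v x * W θ x s y)
    (PY : Θ → Y → ℝ) (hPY : ∀ θ y, PY θ y = ∑ v, pVY θ v y)
    (IS IY : ℝ) (hIS0 : 0 ≤ IS)
    (hIS : IS = ∑ s, ∑ v, PS s * Qv s v * Real.log (Qv s v / PV v))
    (hIY : ∀ θ, IY ≤ ∑ v, ∑ y, pVY θ v y * Real.log (pVY θ v y / (PV v * PY θ y)))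
    (hR : 0 < IY - IS) (ε γ : ℝ) (hε : 0 < ε) (hγ : 0 < γ) :
    ∃ n₀ : ℕ, ∀ n ≥ n₀, ∃ M : ℕ, 1 ≤ M ∧
    ∃ (φ : Fin M → (Fin n → S) → (Fin n → X)) (ψ : (Fin n → Y) → Fin M),
      Real.log M / n ≥ IY - IS - γ ∧
      ∀ m θ, ∑ s : Fin n → S, (∏ i, PS (s i)) * ∑ y : Fin n → Y,
          (∏ i, W θ (φ m s i) (s i) (y i)) * (if ψ y ≠ m then 1 else 0) ≤ ε := by
  set g : ℝ := min γ (IY - IS) / 5 with hgdef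
  have hg : 0 < g := by positivity
  have hg1 : 5 * g ≤ γ := by rw [hgdef]; linarith [min_le_left γ (IY - IS)]
  have hg2 : 5 * g ≤ IY - IS := by rw [hgdef]; linarith [min_le_right γ (IY - IS)]
  obtain ⟨C, hC⟩ := nletter PS hPS0 hPS Qv hQ0 hQ Qx hx0 hx W hW0 hW PV hPVd pVY hpVY PY hPY
    IS IY g hg hIS hIY
  set c : ℝ := (Fintype.card Θ : ℝ) with hc
  have hc0 : 0 ≤ c := by positivity
  have hev := (err_tendsto c C (ε / 4) g hg).eventually (gt_mem_nhds (by linarith : 0 < ε / 4))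
  obtain ⟨N, hN⟩ := Filter.eventually_atTop.1 hev
  refine ⟨max N 1, fun n hn => ?_⟩
  have hn1 : 0 < n := lt_of_lt_of_le one_pos (le_trans (le_max_right N 1) hn)
  have hnr : (0:ℝ) < n := by exact_mod_cast hn1
  have hsmall := hN n (le_trans (le_max_left N 1) hn)
  have hxM : 0 ≤ n * (IY - IS - 5 * g) := mul_nonneg hnr.le (by linarith)
  have hxL : 0 ≤ n * (IS + 2 * g) := mul_nonneg hnr.le (by linarith)
  obtain ⟨hM0, hMl, hMu⟩ := ceil_exp_bounds _ hxM
  obtain ⟨hL0, hLl, hLu⟩ := ceil_exp_bounds _ hxL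
  set M := ⌈Real.exp (n * (IY - IS - 5 * g))⌉₊ with hMdef
  set L := ⌈Real.exp (n * (IS + 2 * g))⌉₊ with hLdef
  obtain ⟨φ, ψ, hφ⟩ := hC n (2 * M) L (ε / 4) hn1 (by omega) hL0 (by linarith)
  let e : Fin (2 * M) → ℝ := fun m => ∑ θ, ∑ s : Fin n → S, (∏ i, PS (s i)) * ∑ y : Fin n → Y,
          (∏ i, W θ (φ m s i) (s i) (y i)) * (if ψ y ≠ m then 1 else 0)
  have hterm0 : ∀ m θ, 0 ≤ ∑ s : Fin n → S, (∏ i, PS (s i)) * ∑ y : Fin n → Y,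
          (∏ i, W θ (φ m s i) (s i) (y i)) * (if ψ y ≠ m then (1:ℝ) else 0) := by
    intro m θ
    exact Finset.sum_nonneg (fun s _ => mul_nonneg (Finset.prod_nonneg (fun i _ => hPS0 _))
      (Finset.sum_nonneg (fun y _ => mul_nonneg (Finset.prod_nonneg (fun i _ => hW0 _ _ _ _))
        (by split_ifs <;> simp))))
  have he0 : ∀ m, 0 ≤ e m := fun m => Finset.sum_nonneg (fun θ _ => hterm0 m θ)
  have hbound : ∑ m, e m ≤ 2 * M * (ε / 2) := by
    refine hφ.trans ?_
    push_cast
    apply mul_le_mul_of_nonneg_left _ (by positivity)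
    have h1 : Real.exp (-(L * Real.exp (-(n * (IS + g))))) ≤ Real.exp (-(Real.exp (n * g))) := by
      apply Real.exp_le_exp.2
      apply neg_le_neg
      calc Real.exp (n * g) = Real.exp (n * (IS + 2 * g)) * Real.exp (-(n * (IS + g))) := by
            rw [← Real.exp_add]; congr 1; ring
        _ ≤ L * Real.exp (-(n * (IS + g))) := by gcongr
    have h2 : 2 * M * L * c * (Real.exp (-(n * (IY - g))) * c)
        ≤ 8 * c * c * Real.exp (-(2 * (n * g))) := by
      calc 2 * M * L * c * (Real.exp (-(n * (IY - g))) * c)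
          ≤ 2 * (2 * Real.exp (n * (IY - IS - 5 * g))) * (2 * Real.exp (n * (IS + 2 * g))) * c
            * (Real.exp (-(n * (IY - g))) * c) := by gcongr
        _ = 8 * c * c * (Real.exp (n * (IY - IS - 5 * g)) * Real.exp (n * (IS + 2 * g))
            * Real.exp (-(n * (IY - g)))) := by ring
        _ = 8 * c * c * Real.exp (-(2 * (n * g))) := by
            rw [← Real.exp_add, ← Real.exp_add]; congr 2; ring
    have h3 : c * (C / n + C / n / (ε / 4) + Real.exp (-(L * Real.exp (-(n * (IS + g))))))
        ≤ c * (C / n + C / n / (ε / 4) + Real.exp (-(Real.exp (n * g)))) := by gcongr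
    linarith
  obtain ⟨ι, hι, hιe⟩ := expurgate M e he0 (ε / 2) (by linarith) hbound
  let ψ' : (Fin n → Y) → Fin M := fun y => if h : ∃ m, ι m = ψ y then h.choose else ⟨0, hM0⟩
  refine ⟨M, hM0, fun m s => φ (ι m) s, ψ', ?_, ?_⟩
  · have : n * (IY - IS - 5 * g) ≤ Real.log M := by
      rw [Real.le_log_iff_exp_le (by exact_mod_cast hM0)]
      exact hMl
    rw [ge_iff_le, le_div_iff₀ hnr]
    nlinarith
  · intro m θ
    have h1 : e (ι m) ≤ ε := by linarith [hιe m]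
    refine le_trans ?_ h1
    refine le_trans ?_ (Finset.single_le_sum (fun θ _ => hterm0 (ι m) θ) (Finset.mem_univ θ))
    apply Finset.sum_le_sum; intro s _
    apply mul_le_mul_of_nonneg_left _ (Finset.prod_nonneg (fun i _ => hPS0 _))
    apply Finset.sum_le_sum; intro y _
    apply mul_le_mul_of_nonneg_left _ (Finset.prod_nonneg (fun i _ => hW0 _ _ _ _))
    by_cases hy : ψ y = ι m
    · have hex : ∃ m, ι m = ψ y := ⟨m, hy.symm⟩
      have : ψ' y = m := by
        simp only [ψ']
        rw [dif_pos hex]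
        apply hι
        rw [hex.choose_spec, hy]
      simp [this, hy]
    · rw [if_pos hy]
      split_ifs <;> simp


lemma mutualInfo_nonneg {A B : Type} [Fintype A] [Fintype B] (p : A × B → ℝ)
    (hp0 : ∀ z, 0 ≤ p z) (hp : ∑ z, p z = 1) : 0 ≤ mutualInfo p := by
  let q : A × B → ℝ := fun z => (∑ b', p (z.1, b')) * (∑ a', p (a', z.2))
  have h1 : ∀ z, p z ≤ ∑ b', p (z.1, b') := fun z =>
    Finset.single_le_sum (f := fun b' => p (z.1, b')) (fun b _ => hp0 _) (Finset.mem_univ z.2)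
  have h2 : ∀ z, p z ≤ ∑ a', p (a', z.2) := fun z =>
    Finset.single_le_sum (f := fun a' => p (a', z.2)) (fun b _ => hp0 _) (Finset.mem_univ z.1)
  have hq0 : ∀ z, 0 ≤ q z := fun z => mul_nonneg ((hp0 z).trans (h1 z)) ((hp0 z).trans (h2 z))
  have hpq : ∀ z, 0 < p z → 0 < q z := fun z hz =>
    mul_pos (hz.trans_le (h1 z)) (hz.trans_le (h2 z))
  have hq : ∑ z, q z ≤ 1 := by
    simp only [q]
    rw [Fintype.sum_prod_type]
    simp only
    rw [← Finset.sum_mul_sum, ← Fintype.sum_prod_type', Finset.sum_comm, ← Fintype.sum_prod_type']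
    simp [hp]
  have hg := gibbs p q hp0 hp hq0 hq hpq
  have : mutualInfo p = ∑ z, p z * Real.log (p z) - ∑ z, p z * Real.log (q z) := by
    rw [mutualInfo, ← Finset.sum_sub_distrib, Fintype.sum_prod_type]
    apply Finset.sum_congr rfl; intro a _
    apply Finset.sum_congr rfl; intro b _
    rcases (hp0 (a, b)).eq_or_lt with h | h
    · rw [← h]; simp
    · rw [Real.log_div h.ne' (hpq _ h).ne']; ring
  linarith

lemma dpi {A B C : Type} [Fintype A] [Fintype B] [Fintype C] (p : A × B → ℝ)
    (hp0 : ∀ z, 0 ≤ p z) (hp : ∑ z, p z = 1) (T : B → C → ℝ) (hT0 : ∀ b c, 0 ≤ T b c)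
    (hT : ∀ b, ∑ c, T b c = 1) (p' : A × C → ℝ) (hp' : ∀ a c, p' (a, c) = ∑ b, p (a, b) * T b c) :
    mutualInfo p' ≤ mutualInfo p := by
  have hp'0 : ∀ z, 0 ≤ p' z := fun z => by
    rw [← Prod.mk.eta (p := z), hp']
    exact Finset.sum_nonneg (fun b _ => mul_nonneg (hp0 _) (hT0 _ _))
  let PA : A → ℝ := fun a => ∑ b, p (a, b)
  let PB : B → ℝ := fun b => ∑ a, p (a, b)
  let PC : C → ℝ := fun c => ∑ a, p' (a, c)
  have hPA' : ∀ a, ∑ c, p' (a, c) = PA a := by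
    intro a
    simp_rw [hp']
    rw [Finset.sum_comm]
    simp_rw [← Finset.mul_sum, hT, mul_one]
    rfl
  have hPB0 : ∀ b, 0 ≤ PB b := fun b => Finset.sum_nonneg (fun a _ => hp0 _)
  have hPC0 : ∀ c, 0 ≤ PC c := fun b => Finset.sum_nonneg (fun a _ => hp'0 _)
  let P : A × B × C → ℝ := fun z => p (z.1, z.2.1) * T z.2.1 z.2.2
  let q : A × B × C → ℝ := fun z => PB z.2.1 * T z.2.1 z.2.2 * (p' (z.1, z.2.2) / PC z.2.2)
  have hP0 : ∀ z, 0 ≤ P z := fun z => mul_nonneg (hp0 _) (hT0 _ _)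
  have hP : ∑ z, P z = 1 := by
    rw [Fintype.sum_prod_type]
    simp_rw [Fintype.sum_prod_type]
    simp only [P]
    simp_rw [← Finset.mul_sum, hT, mul_one]
    rw [← Fintype.sum_prod_type', ]
    exact hp
  have hpos : ∀ a b c, 0 < P (a, b, c) → 0 < p (a, b) ∧ 0 < T b c ∧ 0 < PA a ∧ 0 < PB b ∧
      0 < p' (a, c) ∧ 0 < PC c := by
    intro a b c h
    have h1 : 0 < p (a, b) := pos_of_mul_pos_left h (hT0 _ _)
    have h2 : 0 < T b c := pos_of_mul_pos_right h (hp0 _)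
    have h3 : 0 < p' (a, c) := by
      rw [hp']
      exact lt_of_lt_of_le h (Finset.single_le_sum (f := fun b => p (a, b) * T b c)
        (fun b _ => mul_nonneg (hp0 _) (hT0 _ _)) (Finset.mem_univ b))
    refine ⟨h1, h2, ?_, ?_, h3, ?_⟩
    · exact lt_of_lt_of_le h1 (Finset.single_le_sum (f := fun b => p (a, b))
        (fun b _ => hp0 _) (Finset.mem_univ b))
    · exact lt_of_lt_of_le h1 (Finset.single_le_sum (f := fun a => p (a, b))
        (fun b _ => hp0 _) (Finset.mem_univ a))
    · exact lt_of_lt_of_le h3 (Finset.single_le_sum (f := fun a => p' (a, c))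
        (fun b _ => hp'0 _) (Finset.mem_univ a))
  have hq0 : ∀ z, 0 ≤ q z := fun z =>
    mul_nonneg (mul_nonneg (hPB0 _) (hT0 _ _)) (div_nonneg (hp'0 _) (hPC0 _))
  have hpq : ∀ z, 0 < P z → 0 < q z := by
    rintro ⟨a, b, c⟩ h
    obtain ⟨h1, h2, h3, h4, h5, h6⟩ := hpos a b c h
    exact mul_pos (mul_pos h4 h2) (div_pos h5 h6)
  have hq : ∑ z, q z ≤ 1 := by
    rw [Fintype.sum_prod_type, Finset.sum_comm]
    refine le_trans (b := ∑ z : B × C, PB z.1 * T z.1 z.2) (Finset.sum_le_sum fun z _ => ?_) ?_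
    · simp only [q]
      rw [← Finset.mul_sum, ← Finset.sum_div]
      apply mul_le_of_le_one_right (mul_nonneg (hPB0 _) (hT0 _ _))
      exact div_self_le_one _
    · rw [Fintype.sum_prod_type]
      simp only
      simp_rw [← Finset.mul_sum, hT, mul_one]
      simp only [PB]
      rw [Finset.sum_comm, ← Fintype.sum_prod_type']
      exact hp.le
  have hg := gibbs P q hP0 hP hq0 hq hpq
  have e1 : mutualInfo p = ∑ z : A × B × C, P z *
      Real.log (p (z.1, z.2.1) / (PA z.1 * PB z.2.1)) := by
    rw [mutualInfo, Fintype.sum_prod_type]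
    apply Finset.sum_congr rfl; intro a _
    rw [Fintype.sum_prod_type]
    apply Finset.sum_congr rfl; intro b _
    simp only [P]
    rw [← Finset.sum_mul, ← Finset.mul_sum, hT, mul_one]
  have e2 : mutualInfo p' = ∑ z : A × B × C, P z *
      Real.log (p' (z.1, z.2.2) / (PA z.1 * PC z.2.2)) := by
    rw [mutualInfo, Fintype.sum_prod_type]
    apply Finset.sum_congr rfl; intro a _
    rw [Fintype.sum_prod_type, Finset.sum_comm]
    apply Finset.sum_congr rfl; intro c _
    simp only [P]
    rw [← Finset.sum_mul, hPA', ← hp']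
  have e3 : mutualInfo p - mutualInfo p' = ∑ z, P z * Real.log (P z) - ∑ z, P z * Real.log (q z) := by
    rw [e1, e2, ← Finset.sum_sub_distrib, ← Finset.sum_sub_distrib]
    apply Finset.sum_congr rfl
    rintro ⟨a, b, c⟩ _
    rcases (hP0 (a, b, c)).eq_or_lt with h | h
    · rw [← h]; simp
    · obtain ⟨h1, h2, h3, h4, h5, h6⟩ := hpos a b c h
      simp only [P, q]
      rw [Real.log_div h1.ne' (mul_pos h3 h4).ne', Real.log_div h5.ne' (mul_pos h3 h6).ne',
        Real.log_mul h1.ne' h2.ne', Real.log_mul (mul_pos h4 h2).ne' (div_pos h5 h6).ne',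
        Real.log_mul h4.ne' h2.ne', Real.log_div h5.ne' h6.ne', Real.log_mul h3.ne' h4.ne',
        Real.log_mul h3.ne' h6.ne']
      ring
  linarith

lemma mutualInfo_reindex {A A' B : Type} [Fintype A] [Fintype A'] [Fintype B] (e : A ≃ A')
    (p : A × B → ℝ) (p' : A' × B → ℝ) (h : ∀ a b, p' (e a, b) = p (a, b)) :
    mutualInfo p' = mutualInfo p := by
  unfold mutualInfo
  rw [← Equiv.sum_comp e]
  apply Finset.sum_congr rfl; intro a _
  apply Finset.sum_congr rfl; intro b _
  rw [← Equiv.sum_comp e (fun a' => p' (a', b))]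
  simp_rw [h]


open scoped Classical in
def Pr {Ω A : Type} [Fintype Ω] (p : Ω → ℝ) (f : Ω → A) (a : A) : ℝ :=
  ∑ ω, if f ω = a then p ω else 0

def Hent {Ω A : Type} [Fintype Ω] (p : Ω → ℝ) (f : Ω → A) : ℝ :=
  -∑ ω, p ω * Real.log (Pr p f (f ω))

lemma Pr_nonneg {Ω A : Type} [Fintype Ω] (p : Ω → ℝ) (hp0 : ∀ ω, 0 ≤ p ω) (f : Ω → A) (a : A) :
    0 ≤ Pr p f a := by
  unfold Pr
  exact Finset.sum_nonneg (fun ω _ => by split_ifs <;> simp [hp0])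

lemma le_Pr {Ω A : Type} [Fintype Ω] (p : Ω → ℝ) (hp0 : ∀ ω, 0 ≤ p ω) (f : Ω → A) (ω : Ω) :
    p ω ≤ Pr p f (f ω) := by
  classical
  unfold Pr
  have := Finset.single_le_sum (f := fun ω' => if f ω' = f ω then p ω' else 0)
    (fun ω' _ => by split_ifs <;> simp [hp0]) (Finset.mem_univ ω)
  simp only [if_true] at this
  convert this

lemma Hent_congr {Ω A B : Type} [Fintype Ω] (p : Ω → ℝ) (f : Ω → A) (g : Ω → B)
    (h : ∀ ω ω', f ω = f ω' ↔ g ω = g ω') : Hent p f = Hent p g := by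
  have : ∀ ω, Pr p f (f ω) = Pr p g (g ω) := by
    intro ω
    unfold Pr
    apply Finset.sum_congr rfl; intro ω' _
    by_cases hh : f ω' = f ω
    · rw [if_pos hh, if_pos ((h _ _).1 hh)]
    · rw [if_neg hh, if_neg (fun h' => hh ((h _ _).2 h'))]
  unfold Hent
  simp_rw [this]

lemma sum_push {Ω A : Type} [Fintype Ω] [Fintype A] (p : Ω → ℝ) (f : Ω → A) (F : A → ℝ) :
    ∑ ω, p ω * F (f ω) = ∑ a, Pr p f a * F a := by
  classical
  unfold Pr
  simp_rw [Finset.sum_mul]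
  rw [Finset.sum_comm]
  apply Finset.sum_congr rfl; intro ω _
  rw [Finset.sum_eq_single (f ω)]
  · simp
  · intro b _ hb
    rw [if_neg (Ne.symm hb), zero_mul]
  · simp

lemma sum_Pr {Ω A : Type} [Fintype Ω] [Fintype A] (p : Ω → ℝ) (f : Ω → A) :
    ∑ a, Pr p f a = ∑ ω, p ω := by
  have := sum_push p f (fun _ => 1)
  simpa using this.symm

lemma gibbsH {Ω A : Type} [Fintype Ω] [Fintype A] (p : Ω → ℝ) (hp0 : ∀ ω, 0 ≤ p ω)
    (hp : ∑ ω, p ω = 1) (f : Ω → A) (q : A → ℝ) (hq0 : ∀ a, 0 ≤ q a) (hq : ∑ a, q a ≤ 1)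
    (hpq : ∀ ω, 0 < p ω → 0 < q (f ω)) : Hent p f ≤ -∑ ω, p ω * Real.log (q (f ω)) := by
  classical
  unfold Hent
  rw [sum_push p f (fun a => Real.log (Pr p f a)), sum_push p f (fun a => Real.log (q a))]
  refine neg_le_neg (gibbs _ q (Pr_nonneg p hp0 f) (by rw [sum_Pr, hp]) hq0 hq ?_)
  intro a ha
  by_contra hc
  have : Pr p f a = 0 := by
    unfold Pr
    apply Finset.sum_eq_zero
    intro ω _
    split_ifs with h
    · by_contra h'
      exact hc (h ▸ hpq ω (lt_of_le_of_ne (hp0 ω) (Ne.symm h')))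
    · rfl
  linarith

lemma Pr_fst {Ω A B : Type} [Fintype Ω] [Fintype B] (p : Ω → ℝ) (f : Ω → A) (g : Ω → B) (a : A) :
    ∑ b, Pr p (fun ω => (f ω, g ω)) (a, b) = Pr p f a := by
  classical
  unfold Pr
  rw [Finset.sum_comm]
  apply Finset.sum_congr rfl; intro ω _
  rw [Finset.sum_eq_single (g ω)]
  · simp
  · intro b _ hb
    rw [if_neg]
    intro h
    exact hb (Prod.mk.inj h).2.symm
  · simp

lemma Pr_snd {Ω A B : Type} [Fintype Ω] [Fintype A] (p : Ω → ℝ) (f : Ω → A) (g : Ω → B) (b : B) :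
    ∑ a, Pr p (fun ω => (f ω, g ω)) (a, b) = Pr p g b := by
  classical
  unfold Pr
  rw [Finset.sum_comm]
  apply Finset.sum_congr rfl; intro ω _
  rw [Finset.sum_eq_single (f ω)]
  · simp
  · intro b _ hb
    rw [if_neg]
    intro h
    exact hb (Prod.mk.inj h).1.symm
  · simp

lemma MI_eq {Ω A B : Type} [Fintype Ω] [Fintype A] [Fintype B] (p : Ω → ℝ) (hp0 : ∀ ω, 0 ≤ p ω)
    (f : Ω → A) (g : Ω → B) :
    mutualInfo (Pr p (fun ω => (f ω, g ω))) =
      Hent p f + Hent p g - Hent p (fun ω => (f ω, g ω)) := by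
  unfold mutualInfo
  simp_rw [Pr_fst, Pr_snd]
  rw [← Fintype.sum_prod_type' (f := fun a b => Pr p (fun ω => (f ω, g ω)) (a, b) *
    Real.log (Pr p (fun ω => (f ω, g ω)) (a, b) / (Pr p f a * Pr p g b)))]
  rw [← sum_push p (fun ω => (f ω, g ω)) (fun z =>
    Real.log (Pr p (fun ω => (f ω, g ω)) (z.1, z.2) / (Pr p f z.1 * Pr p g z.2)))]
  unfold Hent
  rw [← sub_eq_zero]
  simp only [sub_neg_eq_add]
  rw [← Finset.sum_neg_distrib, ← Finset.sum_neg_distrib, ← Finset.sum_add_distrib,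
    ← Finset.sum_add_distrib, ← Finset.sum_sub_distrib]
  apply Finset.sum_eq_zero; intro ω _
  rcases (hp0 ω).eq_or_lt with h | h
  · rw [← h]; simp
  · have h1 := h.trans_le (le_Pr p hp0 f ω)
    have h2 := h.trans_le (le_Pr p hp0 g ω)
    have h3 := h.trans_le (le_Pr p hp0 (fun ω => (f ω, g ω)) ω)
    rw [Real.log_div h3.ne' (mul_pos h1 h2).ne', Real.log_mul h1.ne' h2.ne']
    ring


def Ff {Ω A S Y : Type} {n : ℕ} (m : Ω → A) (s : Ω → Fin n → S) (y : Ω → Fin n → Y) (j : ℕ)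
    (ω : Ω) : A × (Fin n → Y ⊕ S) :=
  (m ω, fun l => if l.val < j then Sum.inl (y ω l) else Sum.inr (s ω l))

def Vf {Ω A S Y : Type} {n : ℕ} (m : Ω → A) (s : Ω → Fin n → S) (y : Ω → Fin n → Y) (i : Fin n)
    (ω : Ω) : A × (Fin n → Option (Y ⊕ S)) :=
  (m ω, fun l => if l < i then some (Sum.inl (y ω l)) else
    if l = i then none else some (Sum.inr (s ω l)))

lemma Vf_y {Ω A S Y : Type} {n : ℕ} (m : Ω → A) (s : Ω → Fin n → S) (y : Ω → Fin n → Y) (i : Fin n)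
    (ω ω' : Ω) : (Vf m s y i ω, y ω i) = (Vf m s y i ω', y ω' i) ↔
      Ff m s y (i.val + 1) ω = Ff m s y (i.val + 1) ω' := by
  simp only [Vf, Ff, Prod.mk.injEq, funext_iff]
  constructor
  · rintro ⟨⟨h1, h2⟩, h3⟩
    refine ⟨h1, fun l => ?_⟩
    have := h2 l
    rcases lt_trichotomy l i with h | h | h
    · simp only [h, if_true] at this
      have h' : l.val < i.val + 1 := by have : l.val < i.val := h; omega
      simp only [h', if_true]
      exact Option.some.inj this
    · subst h
      simp [h3]
    · have h' : ¬ l.val < i.val + 1 := by have : i.val < l.val := h; omega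
      simp only [h.not_gt, h.ne', if_false] at this
      simp only [h', if_false]
      exact Option.some.inj this
  · rintro ⟨h1, h2⟩
    refine ⟨⟨h1, fun l => ?_⟩, ?_⟩
    · have := h2 l
      rcases lt_trichotomy l i with h | h | h
      · have h' : l.val < i.val + 1 := by have : l.val < i.val := h; omega
        simp only [h', if_true] at this
        simp only [h, if_true, this]
      · subst h
        simp
      · have h' : ¬ l.val < i.val + 1 := by have : i.val < l.val := h; omega
        simp only [h', if_false] at this
        simp only [h.not_gt, h.ne', if_false, this]
    · have := h2 i
      simpa using this

lemma Vf_s {Ω A S Y : Type} {n : ℕ} (m : Ω → A) (s : Ω → Fin n → S) (y : Ω → Fin n → Y) (i : Fin n)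
    (ω ω' : Ω) : (Vf m s y i ω, s ω i) = (Vf m s y i ω', s ω' i) ↔
      Ff m s y i.val ω = Ff m s y i.val ω' := by
  simp only [Vf, Ff, Prod.mk.injEq, funext_iff]
  constructor
  · rintro ⟨⟨h1, h2⟩, h3⟩
    refine ⟨h1, fun l => ?_⟩
    have := h2 l
    rcases lt_trichotomy l i with h | h | h
    · simp only [h, if_true] at this
      have h' : l.val < i.val := h
      simp only [h', if_true]
      exact Option.some.inj this
    · subst h
      simp [h3]
    · have h' : ¬ l.val < i.val := by have : i.val < l.val := h; omega
      simp only [h.not_gt, h.ne', if_false] at this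
      simp only [h', if_false]
      exact Option.some.inj this
  · rintro ⟨h1, h2⟩
    refine ⟨⟨h1, fun l => ?_⟩, ?_⟩
    · have := h2 l
      rcases lt_trichotomy l i with h | h | h
      · have h' : l.val < i.val := h
        simp only [h', if_true] at this
        simp only [h, if_true, this]
      · subst h
        simp
      · have h' : ¬ l.val < i.val := by have : i.val < l.val := h; omega
        simp only [h', if_false] at this
        simp only [h.not_gt, h.ne', if_false, this]
    · have := h2 i
      simpa using this

lemma tele {Ω A S Y : Type} [Fintype Ω] [Fintype A] [Fintype S] [Fintype Y] {n : ℕ}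
    (p : Ω → ℝ) (hp0 : ∀ ω, 0 ≤ p ω) (m : Ω → A) (s : Ω → Fin n → S) (y : Ω → Fin n → Y) :
    ∑ i, (mutualInfo (Pr p (fun ω => (Vf m s y i ω, y ω i))) -
      mutualInfo (Pr p (fun ω => (Vf m s y i ω, s ω i)))) =
    ∑ i, Hent p (fun ω => y ω i) - ∑ i, Hent p (fun ω => s ω i)
      + Hent p (fun ω => (m ω, s ω)) - Hent p (fun ω => (m ω, y ω)) := by
  have h0 : Hent p (fun ω => (m ω, s ω)) = Hent p (Ff m s y 0) := by
    apply Hent_congr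
    intro ω ω'
    simp [Ff, funext_iff]
  have hn : Hent p (fun ω => (m ω, y ω)) = Hent p (Ff m s y n) := by
    apply Hent_congr
    intro ω ω'
    simp [Ff, funext_iff]
  have ht : Hent p (Ff m s y n) - Hent p (Ff m s y 0) =
      ∑ i : Fin n, (Hent p (Ff m s y (i.val + 1)) - Hent p (Ff m s y i.val)) := by
    rw [Fin.sum_univ_eq_sum_range (fun i => Hent p (Ff m s y (i + 1)) - Hent p (Ff m s y i)),
      Finset.sum_range_sub (fun i => Hent p (Ff m s y i))]
  have : ∀ i, mutualInfo (Pr p (fun ω => (Vf m s y i ω, y ω i))) -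
      mutualInfo (Pr p (fun ω => (Vf m s y i ω, s ω i))) = Hent p (fun ω => y ω i) -
      Hent p (fun ω => s ω i) - (Hent p (Ff m s y (i.val + 1)) - Hent p (Ff m s y i.val)) := by
    intro i
    rw [MI_eq p hp0, MI_eq p hp0, Hent_congr p _ _ (Vf_y m s y i), Hent_congr p _ _ (Vf_s m s y i)]
    ring
  simp_rw [this]
  rw [Finset.sum_sub_distrib, Finset.sum_sub_distrib, ← ht, h0, hn]
  ring

open scoped Classical in
lemma fano {Ω Y : Type} [Fintype Ω] [Fintype Y] {n M : ℕ} (hM : 1 ≤ M)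
    (p : Ω → ℝ) (hp0 : ∀ ω, 0 ≤ p ω) (hp : ∑ ω, p ω = 1) (m : Ω → Fin M) (y : Ω → Fin n → Y)
    (ψ : (Fin n → Y) → Fin M) (ε : ℝ)
    (he : ∑ ω, p ω * (if ψ (y ω) ≠ m ω then 1 else 0) ≤ ε) :
    Hent p (fun ω => (m ω, y ω)) ≤ ∑ i, Hent p (fun ω => y ω i) + Real.log 2 + ε * Real.log M := by
  have hMr : (1:ℝ) ≤ M := by exact_mod_cast hM
  have hM0 : (0:ℝ) < M := by linarith
  let r : Fin M × (Fin n → Y) → ℝ := fun z => if ψ z.2 ≠ z.1 then 1 / (2 * M) else 1 / 2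
  have hr : ∀ z, 0 < r z := by intro z; simp only [r]; split_ifs <;> positivity
  let q : Fin M × (Fin n → Y) → ℝ := fun z => (∏ i, Pr p (fun ω => y ω i) (z.2 i)) * r z
  have hg := gibbsH p hp0 hp (fun ω => (m ω, y ω)) q ?_ ?_ ?_
  · refine hg.trans ?_
    have hl : ∀ ω, p ω * Real.log (q (m ω, y ω)) =
        ∑ i, p ω * Real.log (Pr p (fun ω => y ω i) (y ω i)) - p ω * Real.log 2
          - (p ω * (if ψ (y ω) ≠ m ω then 1 else 0)) * Real.log M := by
      intro ω
      rcases (hp0 ω).eq_or_lt with h | h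
      · rw [← h]; simp
      · have h1 : ∀ i, Pr p (fun ω => y ω i) (y ω i) ≠ 0 := fun i =>
          (h.trans_le (le_Pr p hp0 (fun ω => y ω i) ω)).ne'
        simp only [q]
        rw [Real.log_mul (Finset.prod_ne_zero_iff.2 (fun i _ => h1 i)) (hr _).ne',
          Real.log_prod (fun i _ => h1 i), ← Finset.mul_sum]
        simp only [r]
        split_ifs
        · rw [one_div, Real.log_inv, Real.log_mul two_ne_zero hM0.ne']; ring
        · rw [one_div, Real.log_inv]; ring
    simp_rw [hl]
    rw [Finset.sum_sub_distrib, Finset.sum_sub_distrib, ← Finset.sum_mul, ← Finset.sum_mul, hp,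
      Finset.sum_comm]
    unfold Hent
    rw [Finset.sum_neg_distrib]
    have := mul_le_mul_of_nonneg_right he (Real.log_nonneg hMr)
    linarith
  · intro z
    exact mul_nonneg (Finset.prod_nonneg (fun i _ => Pr_nonneg p hp0 _ _)) (hr z).le
  · rw [Fintype.sum_prod_type, Finset.sum_comm]
    simp only [q]
    have h1 : ∀ y' : Fin n → Y, ∑ a, r (a, y') ≤ 1 := by
      intro y'
      simp only [r]
      have : ∀ a : Fin M, (if ψ y' ≠ a then 1 / (2 * (M:ℝ)) else 1 / 2) ≤
        1 / (2 * M) + if ψ y' = a then 1 / 2 else 0 := by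
        intro a
        by_cases h : ψ y' = a
        · simp [h]
        · simp [h]
      refine (Finset.sum_le_sum (fun a _ => this a)).trans ?_
      rw [Finset.sum_add_distrib]
      simp
      field_simp
      norm_num
    have h2 : ∑ y' : Fin n → Y, ∏ i, Pr p (fun ω => y ω i) (y' i) = 1 :=
      sum_pi_one (fun i a => Pr p (fun ω => y ω i) a) (fun i => by rw [sum_Pr, hp])
    rw [← h2]
    apply Finset.sum_le_sum
    intro y' _
    rw [← Finset.mul_sum]
    exact mul_le_of_le_one_right (Finset.prod_nonneg (fun i _ => Pr_nonneg p hp0 _ _)) (h1 y')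
  · intro ω h
    exact mul_pos (Finset.prod_pos (fun i _ => h.trans_le (le_Pr p hp0 (fun ω => y ω i) ω))) (hr _)

lemma Hms {Ω S : Type} [Fintype Ω] [Fintype S] {n M : ℕ} (hM : 1 ≤ M) (PS : S → ℝ)
    (p : Ω → ℝ) (hp0 : ∀ ω, 0 ≤ p ω) (hp : ∑ ω, p ω = 1) (m : Ω → Fin M) (s : Ω → Fin n → S)
    (h : ∀ a t, Pr p (fun ω => (m ω, s ω)) (a, t) = 1 / M * ∏ i, PS (t i))
    (h' : ∀ i a, Pr p (fun ω => s ω i) a = PS a) :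
    Hent p (fun ω => (m ω, s ω)) = Real.log M + ∑ i, Hent p (fun ω => s ω i) := by
  have hM0 : (M:ℝ) ≠ 0 := by positivity
  have : ∀ ω, p ω * Real.log (Pr p (fun ω => (m ω, s ω)) (m ω, s ω)) =
    ∑ i, p ω * Real.log (Pr p (fun ω => s ω i) (s ω i)) - p ω * Real.log M := by
    intro ω
    rcases (hp0 ω).eq_or_lt with h0 | h0
    · rw [← h0]; simp
    · have h1 : ∀ i, PS (s ω i) ≠ 0 := fun i => by
        rw [← h' i]
        exact (h0.trans_le (le_Pr p hp0 (fun ω => s ω i) ω)).ne'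
      rw [h]
      simp_rw [h']
      rw [Real.log_mul (by positivity) (Finset.prod_ne_zero_iff.2 (fun i _ => h1 i)),
          Real.log_prod (fun i _ => h1 i), ← Finset.mul_sum, one_div, Real.log_inv]
      ring
  unfold Hent
  simp_rw [this]
  rw [Finset.sum_sub_distrib, ← Finset.sum_mul, hp, Finset.sum_comm, Finset.sum_neg_distrib]
  ring


open scoped Classical in
lemma converse {S X Y : Type} [Fintype S] [Fintype X] [Fintype Y]
    (PS : S → ℝ) (hPS0 : ∀ s, 0 ≤ PS s) (hPS : ∑ s, PS s = 1)
    (W : X → S → Y → ℝ) (hW0 : ∀ x s y, 0 ≤ W x s y) (hW : ∀ x s, ∑ y, W x s y = 1)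
    (n M : ℕ) (hn : 0 < n) (hM : 1 ≤ M)
    (φ : Fin M → (Fin n → S) → (Fin n → X)) (ψ : (Fin n → Y) → Fin M) (ε : ℝ)
    (he : ∀ m, ∑ s : Fin n → S, (∏ i, PS (s i)) * ∑ y : Fin n → Y,
          (∏ i, W (φ m s i) (s i) (y i)) * (if ψ y ≠ m then 1 else 0) ≤ ε) :
    ∃ (V : Type) (_ : Fintype V) (q : V → S → X → ℝ), (∀ v s x, 0 ≤ q v s x) ∧
      (∀ s, ∑ v, ∑ x, q v s x = PS s) ∧
      (1 - ε) * Real.log M - Real.log 2 ≤ n *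
        (mutualInfo (fun z : V × Y => ∑ s, ∑ x, q z.1 s x * W x s z.2) -
          mutualInfo (fun z : V × S => ∑ x, q z.1 z.2 x)) := by
  have hM0 : (0:ℝ) < M := by exact_mod_cast hM
  let Ω := Fin M × (Fin n → S) × (Fin n → Y)
  let p : Ω → ℝ := fun ω => 1 / M * (∏ i, PS (ω.2.1 i)) * ∏ i, W (φ ω.1 ω.2.1 i) (ω.2.1 i) (ω.2.2 i)
  have hp0 : ∀ ω, 0 ≤ p ω := fun ω => mul_nonneg (mul_nonneg (by positivity)
    (Finset.prod_nonneg (fun i _ => hPS0 _))) (Finset.prod_nonneg (fun i _ => hW0 _ _ _))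
  have hWn : ∀ (m : Fin M) (s : Fin n → S), ∑ y : Fin n → Y, ∏ i, W (φ m s i) (s i) (y i) = 1 :=
    fun m s => sum_pi_one (fun i b => W (φ m s i) (s i) b) (fun i => hW _ _)
  have hSn : ∑ s : Fin n → S, ∏ i, PS (s i) = 1 :=
    sum_pi_one (fun _ b => PS b) (fun i => hPS)
  -- expectation formula
  have hE : ∀ G : Ω → ℝ, ∑ ω, p ω * G ω = ∑ m, ∑ s : Fin n → S, (1 / M * (∏ i, PS (s i))) *
      ∑ y : Fin n → Y, (∏ i, W (φ m s i) (s i) (y i)) * G (m, s, y) := by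
    intro G
    rw [Fintype.sum_prod_type]
    apply Finset.sum_congr rfl; intro m _
    rw [Fintype.sum_prod_type]
    apply Finset.sum_congr rfl; intro s _
    rw [Finset.mul_sum]
    apply Finset.sum_congr rfl; intro y _
    simp only [p]; ring
  have hE2 : ∀ G : Fin M → (Fin n → S) → ℝ, ∑ ω : Ω, p ω * G ω.1 ω.2.1 =
      ∑ m, ∑ s : Fin n → S, (1 / M * (∏ i, PS (s i))) * G m s := by
    intro G
    rw [hE (fun ω => G ω.1 ω.2.1)]
    simp only
    simp_rw [← Finset.sum_mul, hWn, one_mul]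
  have hp : ∑ ω, p ω = 1 := by
    have := hE2 (fun _ _ => 1)
    simp only [mul_one] at this
    rw [this]
    simp_rw [← Finset.mul_sum, hSn]
    simp
    field_simp
  have hPr : ∀ {A : Type} (f : Ω → A) (a : A), Pr p f a = ∑ ω, p ω * (if f ω = a then 1 else 0) := by
    intro A f a
    unfold Pr
    apply Finset.sum_congr rfl; intro ω _
    split_ifs <;> simp
  let m : Ω → Fin M := fun ω => ω.1
  let s : Ω → Fin n → S := fun ω => ω.2.1
  let y : Ω → Fin n → Y := fun ω => ω.2.2
  let xx : Ω → Fin n → X := fun ω => φ ω.1 ω.2.1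
  have hms : ∀ a t, Pr p (fun ω => (m ω, s ω)) (a, t) = 1 / M * ∏ i, PS (t i) := by
    intro a t
    rw [hPr]
    refine Eq.trans (Finset.sum_congr rfl fun ω _ => ?_)
      ((hE2 (fun m' s' => if (m', s') = (a, t) then 1 else 0)).trans ?_)
    · congr
    rw [Finset.sum_eq_single a, Finset.sum_eq_single t]
    · simp
    · intro b _ hb
      rw [if_neg, mul_zero]
      intro h; exact hb (Prod.mk.inj h).2
    · simp
    · intro b _ hb
      apply Finset.sum_eq_zero; intro c _
      rw [if_neg, mul_zero]
      intro h; exact hb (Prod.mk.inj h).1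
    · simp
  have hs : ∀ i a, Pr p (fun ω => s ω i) a = PS a := by
    intro i a
    rw [hPr, hE2 (fun m' s' => if s' i = a then 1 else 0)]
    have : ∑ s' : Fin n → S, (∏ j, PS (s' j)) * (if s' i = a then (1:ℝ) else 0) = PS a := by
      rw [marg_one (fun _ b => PS b) (fun _ => hPS) i (fun b => if b = a then (1:ℝ) else 0)]
      simp
    simp_rw [mul_assoc, ← Finset.mul_sum, this]
    simp
    field_simp
  have herr : ∑ ω, p ω * (if ψ (y ω) ≠ m ω then 1 else 0) ≤ ε := by
    rw [hE]
    have : ∀ a : Fin M, ∑ s' : Fin n → S, (1 / M * (∏ i, PS (s' i))) *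
      ∑ y' : Fin n → Y, (∏ i, W (φ a s' i) (s' i) (y' i)) *
        (if ψ (y (a, s', y')) ≠ m (a, s', y') then 1 else 0) ≤ 1 / M * ε := by
      intro a
      simp_rw [mul_assoc, ← Finset.mul_sum]
      exact mul_le_mul_of_nonneg_left (he a) (by positivity)
    refine (Finset.sum_le_sum (fun a _ => this a)).trans ?_
    simp
    field_simp
    exact le_rfl
  have ht := tele p hp0 m s y
  have hf := fano hM p hp0 hp m y ψ ε herr
  have hh := Hms hM PS p hp0 hp m s hms hs
  set T : Fin n → ℝ := fun i => mutualInfo (Pr p (fun ω => (Vf m s y i ω, y ω i))) -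
      mutualInfo (Pr p (fun ω => (Vf m s y i ω, s ω i))) with hT
  have hTs : (1 - ε) * Real.log M - Real.log 2 ≤ ∑ i, T i := by
    rw [ht]; linarith
  obtain ⟨i, hi⟩ : ∃ i, (1 - ε) * Real.log M - Real.log 2 ≤ n * T i := by
    by_contra hc
    push Not at hc
    have hnr : (0:ℝ) < n := by exact_mod_cast hn
    have : Nonempty (Fin n) := ⟨⟨0, hn⟩⟩
    have h1 : ∑ i, T i < ∑ _i : Fin n, ((1 - ε) * Real.log M - Real.log 2) / n := by
      apply Finset.sum_lt_sum_of_nonempty Finset.univ_nonempty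
      intro i _
      rw [lt_div_iff₀ hnr, mul_comm]
      exact hc i
    simp at h1
    rw [mul_div_cancel₀ _ hnr.ne'] at h1
    linarith
  refine ⟨Fin M × (Fin n → Option (Y ⊕ S)), inferInstance,
    fun v a x => Pr p (fun ω => ((Vf m s y i ω, s ω i), xx ω i)) ((v, a), x),
    fun v a x => Pr_nonneg p hp0 _ _, ?_, ?_⟩
  · intro a
    simp_rw [Pr_fst p (fun ω => (Vf m s y i ω, s ω i)) (fun ω => xx ω i)]
    rw [Pr_snd p (Vf m s y i) (fun ω => s ω i), hs]
  · refine hi.trans (le_of_eq ?_)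
    simp only [hT]
    congr 2
    · congr 1
      funext z
      obtain ⟨v, b⟩ := z
      simp only
      -- right side
      have hR : ∑ a, ∑ x, Pr p (fun ω => ((Vf m s y i ω, s ω i), xx ω i)) ((v, a), x) * W x a b
          = ∑ ω, p ω * ((if Vf m s y i ω = v then 1 else 0) * W (xx ω i) (s ω i) b) := by
        rw [sum_push p (fun ω => ((Vf m s y i ω, s ω i), xx ω i))
          (fun z => (if z.1.1 = v then 1 else 0) * W z.2 z.1.2 b)]
        rw [Fintype.sum_prod_type, Fintype.sum_prod_type, Finset.sum_eq_single v]
        · simp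
        · intro v' _ hv'
          simp [hv']
        · simp
      rw [hR, hPr, hE, hE]
      apply Finset.sum_congr rfl; intro m' _
      apply Finset.sum_congr rfl; intro s' _
      congr 1
      have hmg := marg (fun j b => W (φ m' s' j) (s' j) b) i (hW _ _)
        (fun y' => if Vf m s y i (m', s', y') = v then 1 else 0) ?_ (fun b' => if b' = b then 1 else 0)
      · simp at hmg
        have e1 : ∑ y' : Fin n → Y, (∏ j, W (φ m' s' j) (s' j) (y' j)) *
            (if (Vf m s y i (m', s', y'), y (m', s', y') i) = (v, b) then (1:ℝ) else 0) =
            ∑ y' : Fin n → Y, if y' i = b then if Vf m s y i (m', s', y') = v then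
              ∏ j, W (φ m' s' j) (s' j) (y' j) else 0 else 0 := by
          apply Finset.sum_congr rfl; intro y' _
          by_cases h1 : y' i = b <;> by_cases h2 : Vf m s y i (m', s', y') = v <;>
            simp [h1, h2, y]
        refine Eq.trans (Finset.sum_congr rfl fun y' _ => ?_) (e1.trans ?_)
        · congr
        rw [hmg, Finset.sum_mul]
        apply Finset.sum_congr rfl; intro y' _
        by_cases h2 : Vf m s y i (m', s', y') = v <;> simp [h2, xx, s]
      · intro c w
        have : Vf m s y i (m', s', Function.update c i w) = Vf m s y i (m', s', c) := by
          simp only [Vf, Prod.mk.injEq]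
          refine ⟨rfl, funext fun l => ?_⟩
          split_ifs with h1 h2
          · simp only [y]; rw [Function.update_of_ne h1.ne]
          · rfl
          · rfl
        rw [this]
    · congr 1
      funext z
      obtain ⟨v, a⟩ := z
      simp only
      rw [Pr_fst p (fun ω => (Vf m s y i ω, s ω i)) (fun ω => xx ω i)]


lemma pmf_sum {A : Type} [Fintype A] (p : PMF A) : ∑ a, (p a).toReal = 1 := by
  rw [← ENNReal.toReal_sum (fun a _ => p.apply_ne_top a)]
  have := p.tsum_coe
  rw [tsum_fintype] at this
  rw [this]; simp

lemma pmf_bind {A B : Type} [Fintype A] (p : PMF A) (f : A → PMF B) (b : B) :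
    ((p.bind f) b).toReal = ∑ a, (p a).toReal * (f a b).toReal := by
  rw [PMF.bind_apply, tsum_fintype, ENNReal.toReal_sum]
  · simp
  · intro a _
    exact ENNReal.mul_ne_top (p.apply_ne_top a) ((f a).apply_ne_top b)

lemma pmf_of_real {A : Type} [Fintype A] (g : A → ℝ) (hg0 : ∀ a, 0 ≤ g a) (hg : ∑ a, g a = 1) :
    ∃ p : PMF A, ∀ a, (p a).toReal = g a := by
  refine ⟨PMF.ofFintype (fun a => ENNReal.ofReal (g a)) ?_, fun a => ?_⟩
  · rw [← ENNReal.ofReal_sum_of_nonneg (fun a _ => hg0 a), hg]; simp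
  · simp [hg0 a]

lemma exists_cond {A : Type} [Fintype A] [Nonempty A] (a : ℝ) (f : A → ℝ) (hf : ∀ x, 0 ≤ f x)
    (h : ∑ x, f x = a) : ∃ g : A → ℝ, (∀ x, 0 ≤ g x) ∧ ∑ x, g x = 1 ∧ ∀ x, f x = a * g x := by
  classical
  by_cases ha : a = 0
  · refine ⟨fun x => if x = Classical.arbitrary A then 1 else 0, fun x => by dsimp only; split_ifs <;> simp,
      by simp, fun x => ?_⟩
    rw [ha, zero_mul]
    rw [ha] at h
    exact (Finset.sum_eq_zero_iff_of_nonneg (fun x _ => hf x)).1 h x (Finset.mem_univ x)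
  · have ha0 : 0 ≤ a := h ▸ Finset.sum_nonneg (fun x _ => hf x)
    refine ⟨fun x => f x / a, fun x => div_nonneg (hf x) ha0, ?_, fun x => ?_⟩
    · rw [← Finset.sum_div, h, div_self ha]
    · field_simp

structure Valid {S V X : Type} [Fintype S] [Fintype V] [Fintype X] (PS : S → ℝ)
    (q : V → S → X → ℝ) : Prop where
  nn : ∀ v s x, 0 ≤ q v s x
  sm : ∀ s, ∑ v, ∑ x, q v s x = PS s

def Jf {S V X Y : Type} [Fintype S] [Fintype V] [Fintype X] [Fintype Y] (W : X → S → Y → ℝ)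
    (q : V → S → X → ℝ) : ℝ :=
  mutualInfo (fun z : V × Y => ∑ s, ∑ x, q z.1 s x * W x s z.2) -
          mutualInfo (fun z : V × S => ∑ x, q z.1 z.2 x)

section
variable {S V X Y : Type} [Fintype S] [Fintype V] [Fintype X] [Fintype Y]

lemma Valid.nonempty {PS : S → ℝ} {q : V → S → X → ℝ} (h : Valid PS q) (hPS : ∑ s, PS s = 1) :
    Nonempty V ∧ Nonempty X := by
  constructor
  · by_contra hc
    rw [not_nonempty_iff] at hc
    simp_rw [← h.sm] at hPS
    simp at hPS
  · by_contra hc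
    rw [not_nonempty_iff] at hc
    simp_rw [← h.sm] at hPS
    simp at hPS

lemma Valid.disint {PS : S → ℝ} {q : V → S → X → ℝ} (h : Valid PS q) (hPS : ∑ s, PS s = 1) :
    ∃ (Qv : S → V → ℝ) (Qx : S → V → X → ℝ), (∀ s v, 0 ≤ Qv s v) ∧ (∀ s, ∑ v, Qv s v = 1) ∧
      (∀ s v x, 0 ≤ Qx s v x) ∧ (∀ s v, ∑ x, Qx s v x = 1) ∧
      (∀ v s, ∑ x, q v s x = PS s * Qv s v) ∧ ∀ v s x, q v s x = PS s * Qv s v * Qx s v x := by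
  obtain ⟨h1, h2⟩ := h.nonempty hPS
  have a1 := fun s => exists_cond (PS s) (fun v => ∑ x, q v s x)
    (fun v => Finset.sum_nonneg (fun x _ => h.nn v s x)) (h.sm s)
  choose Qv b1 b2 b3 using a1
  have a2 := fun s v => exists_cond (PS s * Qv s v) (fun x => q v s x) (fun x => h.nn v s x) (b3 s v)
  choose Qx c1 c2 c3 using a2
  exact ⟨Qv, Qx, b1, b2, c1, c2, fun v s => b3 s v, fun v s x => c3 s v x⟩

lemma Valid.pVY_nonneg {PS : S → ℝ} {q : V → S → X → ℝ} (h : Valid PS q)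
    (W : X → S → Y → ℝ) (hW0 : ∀ x s y, 0 ≤ W x s y) (z : V × Y) :
    0 ≤ ∑ s, ∑ x, q z.1 s x * W x s z.2 :=
  Finset.sum_nonneg (fun s _ => Finset.sum_nonneg (fun x _ => mul_nonneg (h.nn _ _ _) (hW0 _ _ _)))

lemma Valid.pVY_fst {PS : S → ℝ} {q : V → S → X → ℝ} (h : Valid PS q)
    (W : X → S → Y → ℝ) (hW : ∀ x s, ∑ y, W x s y = 1) (v : V) :
    ∑ y, ∑ s, ∑ x, q v s x * W x s y = ∑ s, ∑ x, q v s x := by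
  rw [Finset.sum_comm]
  apply Finset.sum_congr rfl; intro s _
  rw [Finset.sum_comm]
  apply Finset.sum_congr rfl; intro x _
  rw [← Finset.mul_sum, hW, mul_one]

lemma Valid.pVY_sum {PS : S → ℝ} {q : V → S → X → ℝ} (h : Valid PS q) (hPS : ∑ s, PS s = 1)
    (W : X → S → Y → ℝ) (hW : ∀ x s, ∑ y, W x s y = 1) :
    ∑ z : V × Y, ∑ s, ∑ x, q z.1 s x * W x s z.2 = 1 := by
  rw [Fintype.sum_prod_type]
  simp only
  simp_rw [h.pVY_fst W hW]
  rw [Finset.sum_comm]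
  simp_rw [h.sm, hPS]

lemma Valid.IS_nonneg {PS : S → ℝ} {q : V → S → X → ℝ} (h : Valid PS q) (hPS : ∑ s, PS s = 1) :
    0 ≤ mutualInfo (fun z : V × S => ∑ x, q z.1 z.2 x) := by
  apply mutualInfo_nonneg
  · intro z; exact Finset.sum_nonneg (fun x _ => h.nn _ _ _)
  · rw [Fintype.sum_prod_type, Finset.sum_comm]
    simp_rw [h.sm, hPS]

lemma Jf_degrade {PS : S → ℝ} {q : V → S → X → ℝ} (h : Valid PS q) (hPS : ∑ s, PS s = 1)
    (W W' : X → S → Y → ℝ) (hW0 : ∀ x s y, 0 ≤ W x s y) (hW : ∀ x s, ∑ y, W x s y = 1)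
    (T : Y → Y → ℝ) (hT0 : ∀ y z, 0 ≤ T y z) (hT : ∀ y, ∑ z, T y z = 1)
    (hd : ∀ x s z, W' x s z = ∑ y, W x s y * T y z) : Jf W' q ≤ Jf W q := by
  unfold Jf
  apply sub_le_sub_right
  apply dpi _ (h.pVY_nonneg W hW0) (h.pVY_sum hPS W hW) T hT0 hT
  intro a c
  simp only
  simp_rw [hd, Finset.sum_mul]
  symm
  rw [Finset.sum_comm]
  apply Finset.sum_congr rfl; intro s _
  rw [Finset.sum_comm]
  apply Finset.sum_congr rfl; intro x _
  rw [Finset.mul_sum]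
  apply Finset.sum_congr rfl; intro y _
  ring

lemma mutualInfo_le {A B : Type} [Fintype A] [Fintype B] (p : A × B → ℝ)
    (hp0 : ∀ z, 0 ≤ p z) : mutualInfo p ≤ Fintype.card B := by
  unfold mutualInfo
  rw [Finset.sum_comm]
  have : ∀ b : B, ∑ a, p (a, b) *
      Real.log (p (a, b) / ((∑ b' : B, p (a, b')) * (∑ a' : A, p (a', b)))) ≤ 1 := by
    intro b
    have hPB0 : 0 ≤ ∑ a', p (a', b) := Finset.sum_nonneg (fun a _ => hp0 _)
    have h1 : ∀ a, p (a, b) *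
      Real.log (p (a, b) / ((∑ b' : B, p (a, b')) * (∑ a' : A, p (a', b)))) ≤
        p (a, b) / ∑ a', p (a', b) := by
      intro a
      rcases (hp0 (a, b)).eq_or_lt with h | h
      · rw [← h]; simp
      · have hA : p (a, b) ≤ ∑ b', p (a, b') :=
          Finset.single_le_sum (f := fun b' => p (a, b')) (fun b _ => hp0 _) (Finset.mem_univ b)
        have hB : p (a, b) ≤ ∑ a', p (a', b) :=
          Finset.single_le_sum (f := fun a' => p (a', b)) (fun b _ => hp0 _) (Finset.mem_univ a)
        have hA0 := h.trans_le hA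
        have hB0 := h.trans_le hB
        have := Real.log_le_sub_one_of_pos (div_pos h (mul_pos hA0 hB0))
        have h2 : p (a, b) / ((∑ b' : B, p (a, b')) * (∑ a' : A, p (a', b))) ≤
            1 / (∑ a' : A, p (a', b)) := by
          rw [div_le_div_iff₀ (mul_pos hA0 hB0) hB0]
          nlinarith
        calc _ ≤ p (a, b) * (1 / (∑ a' : A, p (a', b))) := by
              apply mul_le_mul_of_nonneg_left _ h.le; linarith
          _ = _ := by ring
    refine (Finset.sum_le_sum (fun a _ => h1 a)).trans ?_
    rw [← Finset.sum_div]
    exact div_self_le_one _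
  refine (Finset.sum_le_sum (fun b _ => this b)).trans ?_
  simp

lemma Jf_le {PS : S → ℝ} {q : V → S → X → ℝ} (h : Valid PS q) (hPS : ∑ s, PS s = 1)
    (W : X → S → Y → ℝ) (hW0 : ∀ x s y, 0 ≤ W x s y) : Jf W q ≤ Fintype.card Y := by
  have h1 := h.IS_nonneg hPS
  have h2 := mutualInfo_le _ (h.pVY_nonneg W hW0)
  unfold Jf
  linarith

lemma achJ {Θ : Type} [Fintype Θ] (PS : PMF S) (W : Θ → X → S → PMF Y) (q : V → S → X → ℝ)
    (h : Valid (fun s => (PS s).toReal) q) (J : ℝ)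
    (hJ : ∀ θ, J ≤ Jf (fun x s y => (W θ x s y).toReal) q) :
    ∃ R, J ≤ R ∧ IsAchievable W PS R := by
  classical
  have hPS := pmf_sum PS
  obtain ⟨hV, hX⟩ := h.nonempty hPS
  by_cases hJ0 : J ≤ 0
  · refine ⟨0, hJ0, le_rfl, fun ε hε γ hγ => ⟨0, fun n _ => ⟨1, le_rfl, fun _ _ _ => Classical.arbitrary X,
      fun _ => 0, ?_, ?_⟩⟩⟩
    · simp; exact hγ.1.le
    · intro m θ
      have : m = 0 := Subsingleton.elim _ _
      subst this
      simp [avgError]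
      exact hε.1.le
  · push Not at hJ0
    refine ⟨J, le_rfl, hJ0.le, fun ε hε γ hγ => ?_⟩
    obtain ⟨Qv, Qx, b1, b2, c1, c2, b3, c3⟩ := h.disint hPS
    have hIS0 := h.IS_nonneg hPS
    set IS := mutualInfo (fun z : V × S => ∑ x, q z.1 z.2 x) with hIS
    have key := ach (fun s => (PS s).toReal) (fun s => ENNReal.toReal_nonneg) hPS Qv b1 b2 Qx c1 c2
      (fun θ x s y => (W θ x s y).toReal) (fun _ _ _ _ => ENNReal.toReal_nonneg)
      (fun θ x s => pmf_sum _) (fun v => ∑ s, ∑ x, q v s x) (fun v => by simp_rw [b3])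
      (fun θ v y => ∑ s, ∑ x, q v s x * (W θ x s y).toReal)
      (fun θ v y => by
        apply Finset.sum_congr rfl; intro s _
        rw [Finset.mul_sum]
        apply Finset.sum_congr rfl; intro x _
        rw [c3]; ring)
      (fun θ y => ∑ v, ∑ s, ∑ x, q v s x * (W θ x s y).toReal) (fun _ _ => rfl)
      IS (J + IS) hIS0 ?_ ?_ (by linarith) ε γ hε.1 hγ.1
    · obtain ⟨n₀, hn⟩ := key
      refine ⟨n₀, fun n h => ?_⟩
      obtain ⟨M, hM, φ, ψ, hR, he⟩ := hn n h
      refine ⟨M, hM, φ, ψ, by linarith, fun m θ => ?_⟩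
      have := he m θ
      unfold avgError
      convert this
    · rw [hIS, mutualInfo, Finset.sum_comm]
      apply Finset.sum_congr rfl; intro s _
      apply Finset.sum_congr rfl; intro v _
      dsimp only
      rw [h.sm, b3]
      by_cases hz : (PS s).toReal = 0
      · rw [hz]; simp
      · congr 2
        rw [mul_comm (∑ b', ∑ x, q v b' x), mul_div_mul_comm, div_self hz, one_mul]
    · intro θ
      have := hJ θ
      unfold Jf at this
      refine (by linarith : J + IS ≤ _).trans (le_of_eq ?_)
      · rw [mutualInfo]
        apply Finset.sum_congr rfl; intro v _
        apply Finset.sum_congr rfl; intro y _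
        dsimp only
        rw [h.pVY_fst (fun x s y => (W θ x s y).toReal) (fun x s => pmf_sum _)]
end


lemma attach_prod (k : ℕ) (G : (j : ℕ) → j < k → ℝ) :
    ∏ j ∈ (Finset.range k).attach, G j.1 (Finset.mem_range.1 j.2) = ∏ j : Fin k, G j.1 j.2 := by
  apply Finset.prod_bij (fun j _ => (⟨j.1, Finset.mem_range.1 j.2⟩ : Fin k))
  · intro a _; exact Finset.mem_univ _
  · intro a _ b _ h
    apply Subtype.ext
    exact congrArg Fin.val h
  · intro b _
    exact ⟨⟨b.1, Finset.mem_range.2 b.2⟩, Finset.mem_attach _ _, rfl⟩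
  · intro a _; rfl

lemma chain_sum (k : ℕ) : ∀ (n : ℕ → ℕ) (f : Fin (n k) → ℝ)
    (q : (j : ℕ) → Fin (n (j + 1)) → Fin (n j) → ℝ) (_ : ∀ j b, ∑ a, q j b a = 1),
    ∑ v : (j : Fin (k + 1)) → Fin (n j.val), f (v ⟨k, by omega⟩) *
      ∏ j : Fin k, q j.1 (v ⟨j.1 + 1, by omega⟩) (v ⟨j.1, by omega⟩) = ∑ a, f a := by
  induction k with
  | zero =>
    intro n f q _
    simp only [Finset.univ_eq_empty, Finset.prod_empty, mul_one]
    exact Fintype.sum_equiv (Equiv.piUnique (fun j : Fin 1 => Fin (n j.val))) _ _ (fun v => rfl)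
  | succ k ih =>
    intro n f q hq
    rw [← (Fin.consEquiv (fun j : Fin (k + 1 + 1) => Fin (n j.val))).sum_comp]
    rw [Fintype.sum_prod_type, Finset.sum_comm]
    rw [← ih (fun j => n (j + 1)) f (fun j => q (j + 1)) (fun j => hq (j + 1))]
    apply Finset.sum_congr rfl; intro v _
    simp only [Fin.prod_univ_succ]
    have : ∀ a : Fin (n 0), f ((Fin.consEquiv (fun j : Fin (k + 1 + 1) => Fin (n j.val))) (a, v)
        ⟨k + 1, by omega⟩) * (q 0 (v 0) a *
          ∏ j : Fin k, q (j.1 + 1) (v ⟨j.1 + 1, by omega⟩) (v ⟨j.1, by omega⟩)) =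
        q 0 (v 0) a * (f (v ⟨k, by omega⟩) *
          ∏ j : Fin k, q (j.1 + 1) (v ⟨j.1 + 1, by omega⟩) (v ⟨j.1, by omega⟩)) := by
      intro a
      have : (Fin.consEquiv (fun j : Fin (k + 1 + 1) => Fin (n j.val))) (a, v)
        ⟨k + 1, by omega⟩ = v ⟨k, by omega⟩ := rfl
      rw [this]; ring
    refine (Finset.sum_congr rfl (fun a _ => this a)).trans ?_
    refine (Finset.sum_mul (Finset.univ : Finset (Fin (n 0))) (fun a => q 0 (v 0) a) _).symm.trans ?_
    exact (congrArg (· * _) (hq 0 (v 0))).trans (one_mul _)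

section

def gch {K : ℕ} (hK : 1 ≤ K) (PS : PMF 𝒮) (n : ℕ → ℕ)
    (Qtop : 𝒮 → PMF (Fin (n (K - 1))))
    (Q : (j : ℕ) → 𝒮 → Fin (n (j + 1)) → PMF (Fin (n j)))
    (QX : 𝒮 → Fin (n 0) → PMF 𝒳)
    (v : (j : Fin K) → Fin (n j.val)) (s : 𝒮) (x : 𝒳) : ℝ :=
  (PS s).toReal * ((Qtop s) (v ⟨K - 1, by omega⟩)).toReal *
    (∏ j ∈ (Finset.range (K - 1)).attach,
      ((Q j.1 s (v ⟨j.1 + 1, by have := Finset.mem_range.mp j.2; omega⟩))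
        (v ⟨j.1, by have := Finset.mem_range.mp j.2; omega⟩)).toReal) *
    ((QX s (v ⟨0, by omega⟩)) x).toReal

lemma gch_nonneg {K : ℕ} (hK : 1 ≤ K) (PS : PMF 𝒮) (n : ℕ → ℕ)
    (Qtop : 𝒮 → PMF (Fin (n (K - 1))))
    (Q : (j : ℕ) → 𝒮 → Fin (n (j + 1)) → PMF (Fin (n j)))
    (QX : 𝒮 → Fin (n 0) → PMF 𝒳)
    (v : (j : Fin K) → Fin (n j.val)) (s : 𝒮) (x : 𝒳) : 0 ≤ gch hK PS n Qtop Q QX v s x := by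
  unfold gch
  refine mul_nonneg (mul_nonneg (mul_nonneg ENNReal.toReal_nonneg ENNReal.toReal_nonneg)
    (Finset.prod_nonneg (fun j _ => ENNReal.toReal_nonneg))) ENNReal.toReal_nonneg

lemma gch_sum {K : ℕ} (hK : 1 ≤ K) (PS : PMF 𝒮) (n : ℕ → ℕ)
    (Qtop : 𝒮 → PMF (Fin (n (K - 1))))
    (Q : (j : ℕ) → 𝒮 → Fin (n (j + 1)) → PMF (Fin (n j)))
    (QX : 𝒮 → Fin (n 0) → PMF 𝒳) (s : 𝒮) :
    ∑ v : (j : Fin K) → Fin (n j.val), ∑ x, gch hK PS n Qtop Q QX v s x = (PS s).toReal := by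
  obtain ⟨k, rfl⟩ : ∃ k, K = k + 1 := ⟨K - 1, by omega⟩
  unfold gch
  simp_rw [← Finset.mul_sum, pmf_sum, mul_one]
  have h := chain_sum k n (fun a => (PS s).toReal * ((Qtop s) a).toReal)
    (fun j b a => ((Q j s b) a).toReal) (fun j b => pmf_sum _)
  rw [← Finset.mul_sum] at h
  have h2 : ∑ a, ((Qtop s) a).toReal = 1 := pmf_sum _
  refine Eq.trans (Finset.sum_congr rfl fun v _ => ?_) (h.trans ?_)
  · congr 1
    exact attach_prod k (fun j hj => ((Q j s (v ⟨j + 1, by omega⟩)) (v ⟨j, by omega⟩)).toReal)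
  · exact (congrArg (_ * ·) h2).trans (mul_one _)

def qch {K : ℕ} (hK : 1 ≤ K) (PS : PMF 𝒮) (n : ℕ → ℕ)
    (Qtop : 𝒮 → PMF (Fin (n (K - 1))))
    (Q : (j : ℕ) → 𝒮 → Fin (n (j + 1)) → PMF (Fin (n j)))
    (QX : 𝒮 → Fin (n 0) → PMF 𝒳) (k : Fin K) (a : Fin (n k.val)) (s : 𝒮) (x : 𝒳) : ℝ :=
  ∑ v : (j : Fin K) → Fin (n j.val), if v k = a then gch hK PS n Qtop Q QX v s x else 0

lemma qch_valid {K : ℕ} (hK : 1 ≤ K) (PS : PMF 𝒮) (n : ℕ → ℕ)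
    (Qtop : 𝒮 → PMF (Fin (n (K - 1))))
    (Q : (j : ℕ) → 𝒮 → Fin (n (j + 1)) → PMF (Fin (n j)))
    (QX : 𝒮 → Fin (n 0) → PMF 𝒳) (k : Fin K) :
    Valid (fun s => (PS s).toReal) (qch hK PS n Qtop Q QX k) := by
  constructor
  · intro v s x
    unfold qch
    refine Finset.sum_nonneg fun v _ => ?_
    split_ifs
    · exact gch_nonneg _ _ _ _ _ _ _ _ _
    · exact le_rfl
  · intro s
    rw [← gch_sum hK PS n Qtop Q QX s, Finset.sum_comm]
    conv_rhs => rw [Finset.sum_comm]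
    apply Finset.sum_congr rfl; intro x _
    unfold qch
    rw [Finset.sum_comm]
    apply Finset.sum_congr rfl; intro v _
    simp

def term {K : ℕ} (hK : 1 ≤ K) (W : Fin K → 𝒳 → 𝒮 → PMF 𝒴) (PS : PMF 𝒮) (n : ℕ → ℕ)
    (Qtop : 𝒮 → PMF (Fin (n (K - 1))))
    (Q : (j : ℕ) → 𝒮 → Fin (n (j + 1)) → PMF (Fin (n j)))
    (QX : 𝒮 → Fin (n 0) → PMF 𝒳) (k : Fin K) : ℝ :=
              mutualInfo (fun q : Fin (n k.val) × 𝒴 =>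
                ∑ v : (j : Fin K) → Fin (n j.val), ∑ s : 𝒮, ∑ x : 𝒳,
                  if v k = q.1 then
                    jointChain hK PS n Qtop Q QX (W k) v s x q.2
                  else 0) -
              mutualInfo (fun q : Fin (n k.val) × 𝒮 =>
                ∑ v : (j : Fin K) → Fin (n j.val), ∑ x : 𝒳, ∑ y : 𝒴,
                  if v k = q.1 then
                    jointChain hK PS n Qtop Q QX (W k) v q.2 x y
                  else 0)

lemma term_eq {K : ℕ} (hK : 1 ≤ K) (W : Fin K → 𝒳 → 𝒮 → PMF 𝒴) (PS : PMF 𝒮) (n : ℕ → ℕ)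
    (Qtop : 𝒮 → PMF (Fin (n (K - 1))))
    (Q : (j : ℕ) → 𝒮 → Fin (n (j + 1)) → PMF (Fin (n j)))
    (QX : 𝒮 → Fin (n 0) → PMF 𝒳) (k : Fin K) :
    term hK W PS n Qtop Q QX k =
      Jf (fun x s y => (W k x s y).toReal) (qch hK PS n Qtop Q QX k) := by
  have hj : ∀ v s x y, jointChain hK PS n Qtop Q QX (W k) v s x y =
    gch hK PS n Qtop Q QX v s x * (W k x s y).toReal := fun v s x y => rfl
  unfold term Jf
  congr 2
  · funext z
    rw [Finset.sum_comm]
    apply Finset.sum_congr rfl; intro s _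
    rw [Finset.sum_comm]
    apply Finset.sum_congr rfl; intro x _
    unfold qch
    rw [Finset.sum_mul]
    apply Finset.sum_congr rfl; intro v _
    rw [hj]
    split_ifs <;> simp
  · funext z
    rw [Finset.sum_comm]
    apply Finset.sum_congr rfl; intro x _
    unfold qch
    apply Finset.sum_congr rfl; intro v _
    split_ifs
    · simp_rw [hj]
      rw [← Finset.mul_sum, pmf_sum, mul_one]
    · simp

lemma qch_pure {K : ℕ} (hK : 1 ≤ K) (PS : PMF 𝒮) (N : ℕ)
    (Qtop : 𝒮 → PMF (Fin N)) (QX : 𝒮 → Fin N → PMF 𝒳) (k : Fin K) (a : Fin N) (s : 𝒮) (x : 𝒳) :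
    qch hK PS (fun _ => N) Qtop (fun _ _ v => PMF.pure v) QX k a s x =
      (PS s).toReal * (Qtop s a).toReal * (QX s a x).toReal := by
  have : Nonempty (Fin K) := ⟨k⟩
  unfold qch
  have h := Fintype.sum_of_injective (fun (c : Fin N) (_ : Fin K) => c)
    (fun c c' h => congrFun h k)
    (fun c => if c = a then (PS s).toReal * (Qtop s c).toReal * (QX s c x).toReal else 0)
    (fun v : Fin K → Fin N => if v k = a then
      gch hK PS (fun _ => N) Qtop (fun _ _ v => PMF.pure v) QX v s x else 0) ?_ ?_
  · refine h.symm.trans ?_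
    simp
  · intro v hv
    split_ifs
    · by_contra hne
      apply hv
      unfold gch at hne
      have h1 := right_ne_zero_of_mul (left_ne_zero_of_mul hne)
      rw [Finset.prod_ne_zero_iff] at h1
      have h2 : ∀ j (hj : j + 1 < K), v ⟨j, by omega⟩ = v ⟨j + 1, hj⟩ := by
        intro j hj
        have := h1 ⟨j, Finset.mem_range.2 (by omega)⟩ (Finset.mem_attach _ _)
        by_contra hcc
        apply this
        simp [PMF.pure_apply, hcc]
      have h3 : ∀ j (hj : j < K), v ⟨j, hj⟩ = v ⟨0, hK⟩ := by
        intro j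
        induction j with
        | zero => intro hj; rfl
        | succ j ih =>
          intro hj
          rw [← h2 j hj, ih]
      exact ⟨v ⟨0, hK⟩, funext fun j => (h3 j.1 j.2).symm⟩
    · rfl
  · intro c
    dsimp only
    split_ifs
    · unfold gch
      simp
    · rfl

lemma deg_all {K : ℕ} (hK : 1 ≤ K) (W : Fin K → 𝒳 → 𝒮 → PMF 𝒴) (PS : PMF 𝒮)
    (hdeg : ∀ (k : ℕ) (h : k + 1 < K), ∃ Wt : 𝒴 → PMF 𝒴, ∀ x s,
      W ⟨k + 1, h⟩ x s = (W ⟨k, Nat.lt_of_succ_lt h⟩ x s).bind Wt) {V : Type} [Fintype V]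
    (q : V → 𝒮 → 𝒳 → ℝ) (hq : Valid (fun s => (PS s).toReal) q) (k : Fin K) :
    Jf (fun x s y => (W ⟨K - 1, by omega⟩ x s y).toReal) q ≤
      Jf (fun x s y => (W k x s y).toReal) q := by
  have h : ∀ d k (hk : k < K), k + d = K - 1 →
      Jf (fun x s y => (W ⟨K - 1, by omega⟩ x s y).toReal) q ≤
      Jf (fun x s y => (W ⟨k, hk⟩ x s y).toReal) q := by
    intro d
    induction d with
    | zero =>
      intro k hk h
      obtain rfl : k = K - 1 := by omega
      exact le_rfl
    | succ d ih =>
      intro k hk h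
      refine (ih (k + 1) (by omega) (by omega)).trans ?_
      obtain ⟨Wt, hWt⟩ := hdeg k (by omega)
      refine Jf_degrade hq (pmf_sum PS) _ _ (fun _ _ _ => ENNReal.toReal_nonneg)
        (fun x s => pmf_sum _) (fun y z => (Wt y z).toReal) (fun _ _ => ENNReal.toReal_nonneg)
        (fun y => pmf_sum _) ?_
      intro x s z
      rw [hWt, pmf_bind]
  exact h (K - 1 - k.val) k.val k.2 (by omega)

lemma Jf_reindex {V V' : Type} [Fintype V] [Fintype V'] (e : V ≃ V') (W : 𝒳 → 𝒮 → 𝒴 → ℝ)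
    (q : V → 𝒮 → 𝒳 → ℝ) : Jf W (fun v => q (e.symm v)) = Jf W q := by
  unfold Jf
  rw [mutualInfo_reindex e (fun z : V × 𝒴 => ∑ s, ∑ x, q z.1 s x * W x s z.2) _ (by simp),
    mutualInfo_reindex e (fun z : V × 𝒮 => ∑ x, q z.1 z.2 x) _ (by simp)]

end


/-- Theorem 4: capacity of the compound DMC with stochastically degraded
components `W_K ⪯ W_{K−1} ⪯ ⋯ ⪯ W_1` (here `0`-based: `W ⟨k+1,_⟩` is a
stochastically degraded version of `W ⟨k,_⟩`) and states known non-causally at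
the transmitter only.  The capacity — the supremum of all achievable rates —
equals the supremum, over all chains of finite auxiliary alphabets and kernels
`Q_K : 𝒮 → PMF 𝒱_K`, `Q_j : 𝒮 × 𝒱_{j+1} → PMF 𝒱_j`, `Q_X : 𝒮 × 𝒱_1 → PMF 𝒳`,
of `min_k [ I(V_k;Y_k) − I(V_k;S) ]`. -/
theorem degraded_compound_capacity {K : ℕ} (hK : 1 ≤ K)
    (W : Fin K → 𝒳 → 𝒮 → PMF 𝒴) (PS : PMF 𝒮)
    (hdeg : ∀ (k : ℕ) (h : k + 1 < K), ∃ Wt : 𝒴 → PMF 𝒴, ∀ x s,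
      W ⟨k + 1, h⟩ x s = (W ⟨k, by omega⟩ x s).bind Wt) :
    sSup {R : ℝ | IsAchievable W PS R} =
      sSup {r : ℝ |
        ∃ (n : ℕ → ℕ) (_ : ∀ j, 1 ≤ n j)
          (Qtop : 𝒮 → PMF (Fin (n (K - 1))))
          (Q : (j : ℕ) → 𝒮 → Fin (n (j + 1)) → PMF (Fin (n j)))
          (QX : 𝒮 → Fin (n 0) → PMF 𝒳),
          r = Finset.univ.inf'
            (by haveI : Nonempty (Fin K) := ⟨⟨0, hK⟩⟩; exact Finset.univ_nonempty)
            (fun k : Fin K =>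
              mutualInfo (fun q : Fin (n k.val) × 𝒴 =>
                ∑ v : (j : Fin K) → Fin (n j.val), ∑ s : 𝒮, ∑ x : 𝒳,
                  if v k = q.1 then
                    jointChain hK PS n Qtop Q QX (W k) v s x q.2
                  else 0) -
              mutualInfo (fun q : Fin (n k.val) × 𝒮 =>
                ∑ v : (j : Fin K) → Fin (n j.val), ∑ x : 𝒳, ∑ y : 𝒴,
                  if v k = q.1 then
                    jointChain hK PS n Qtop Q QX (W k) v q.2 x y
                  else 0))} := by
  classical
  set A := {R : ℝ | IsAchievable W PS R} with hAdef
  set B : Set ℝ := _ with hBdef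
  change sSup A = sSup B
  have hPS := pmf_sum PS
  set L : Fin K := ⟨K - 1, by omega⟩ with hL
  let WL : 𝒳 → 𝒮 → 𝒴 → ℝ := fun x s y => (W L x s y).toReal
  have hWL0 : ∀ x s y, 0 ≤ WL x s y := fun _ _ _ => ENNReal.toReal_nonneg
  have hWL : ∀ x s, ∑ y, WL x s y = 1 := fun _ _ => pmf_sum _
  -- every element of B is bounded by a valid value
  have fA : ∀ r ∈ B, ∃ (V : Type) (_ : Fintype V) (q : V → 𝒮 → 𝒳 → ℝ),
      Valid (fun s => (PS s).toReal) q ∧ r ≤ Jf WL q := by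
    rintro r ⟨n, hn, Qtop, Q, QX, rfl⟩
    refine ⟨Fin (n L.val), inferInstance, qch hK PS n Qtop Q QX L, qch_valid _ _ _ _ _ _ _, ?_⟩
    refine (Finset.inf'_le _ (Finset.mem_univ L)).trans (le_of_eq ?_)
    exact term_eq hK W PS n Qtop Q QX L
  have fB : ∀ (V : Type) (_ : Fintype V) (q : V → 𝒮 → 𝒳 → ℝ),
      Valid (fun s => (PS s).toReal) q → ∃ r ∈ B, Jf WL q ≤ r := by
    intro V _ q hq
    let e := Fintype.equivFin V
    set N := Fintype.card V with hN
    obtain ⟨hV, hX⟩ := hq.nonempty hPS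
    have hN1 : 1 ≤ N := Fintype.card_pos
    let q' : Fin N → 𝒮 → 𝒳 → ℝ := fun v => q (e.symm v)
    have hq' : Valid (fun s => (PS s).toReal) q' := by
      constructor
      · intro v s x; exact hq.nn _ _ _
      · intro s
        rw [← hq.sm s]
        exact Equiv.sum_comp e.symm (fun v => ∑ x, q v s x)
    obtain ⟨Qv, Qx, b1, b2, c1, c2, b3, c3⟩ := hq'.disint hPS
    choose Qtop hQtop using fun s => pmf_of_real (Qv s) (b1 s) (b2 s)
    choose QX hQX using fun s v => pmf_of_real (Qx s v) (c1 s v) (c2 s v)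
    refine ⟨_, ⟨fun _ => N, fun _ => hN1, Qtop, fun _ _ v => PMF.pure v, QX, rfl⟩, ?_⟩
    apply Finset.le_inf'
    intro k _
    refine le_of_le_of_eq ?_ (term_eq hK W PS (fun _ => N) Qtop (fun _ _ v => PMF.pure v) QX k).symm
    have : qch hK PS (fun _ => N) Qtop (fun _ _ v => PMF.pure v) QX k = q' := by
      funext a s x
      rw [qch_pure, c3, hQtop, hQX]
    rw [this]
    rw [← Jf_reindex e WL q]
    exact deg_all hK W PS hdeg q' hq' k
  have fC : ∀ (V : Type) (_ : Fintype V) (q : V → 𝒮 → 𝒳 → ℝ),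
      Valid (fun s => (PS s).toReal) q → ∃ R ∈ A, Jf WL q ≤ R := by
    intro V _ q hq
    obtain ⟨R, h1, h2⟩ := achJ PS W q hq (Jf WL q) (fun k => deg_all hK W PS hdeg q hq k)
    exact ⟨R, h2, h1⟩
  have fD : ∀ R ∈ A, ∀ ε ∈ Set.Ioo (0 : ℝ) 1, ∀ γ ∈ Set.Ioo (0 : ℝ) 1, ∀ n₁ : ℕ, ∃ n ≥ n₁, 0 < n ∧
      ∃ (V : Type) (_ : Fintype V) (q : V → 𝒮 → 𝒳 → ℝ),
      Valid (fun s => (PS s).toReal) q ∧ (1 - ε) * (R - γ) - Real.log 2 / n ≤ Jf WL q := by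
    rintro R ⟨hR0, hR⟩ ε hε γ hγ n₁
    obtain ⟨n₀, h⟩ := hR ε hε γ hγ
    obtain ⟨n, hndef⟩ : ∃ n, n = max (max n₀ n₁) 1 := ⟨_, rfl⟩
    have hn : 0 < n := by simp [hndef]
    obtain ⟨M, hM, φ, ψ, hlog, herr⟩ := h n (by simp [hndef])
    have hnr : (0:ℝ) < n := by exact_mod_cast hn
    refine ⟨n, by simp [hndef], hn, ?_⟩
    have hcv := converse (fun s => (PS s).toReal)
      (fun s => ENNReal.toReal_nonneg) hPS WL hWL0 hWL n M hn hM φ ψ ε ?_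
    · obtain ⟨V, hV, q, h1, h2, h3⟩ := hcv
      refine ⟨V, hV, q, ⟨h1, h2⟩, ?_⟩
      have h4 : (1 - ε) * Real.log M - Real.log 2 ≤ n * Jf WL q := h3
      have h5 : (1 - ε) * (R - γ) ≤ (1 - ε) * (Real.log M / n) :=
        mul_le_mul_of_nonneg_left hlog (by linarith [hε.2])
      have h6 : ((1 - ε) * Real.log M - Real.log 2) / n ≤ Jf WL q := by
        rw [div_le_iff₀ hnr]; linarith
      have h7 : ((1 - ε) * Real.log M - Real.log 2) / n =
        (1 - ε) * (Real.log M / n) - Real.log 2 / n := by ring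
      linarith
    · intro m
      have := herr m L
      unfold avgError at this
      convert this
  have hBb : BddAbove B := by
    refine ⟨Fintype.card 𝒴, fun r hr => ?_⟩
    obtain ⟨V, _, q, hq, h⟩ := fA r hr
    exact h.trans (Jf_le hq hPS WL hWL0)
  have hle : ∀ R ∈ A, R ≤ sSup B := by
    intro R hR
    by_contra hc
    push Not at hc
    set C := sSup B with hC
    have hR0 : 0 ≤ R := hR.1
    set δ := R - C with hδ
    have hδ0 : 0 < δ := by linarith
    obtain ⟨n₁, hn₁⟩ := exists_nat_gt (4 * Real.log 2 / δ)
    have hε : min (1 / 2) (δ / (4 * (R + 1))) ∈ Set.Ioo (0:ℝ) 1 :=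
      ⟨by positivity, lt_of_le_of_lt (min_le_left _ _) (by norm_num)⟩
    have hγ : min (1 / 2) (δ / 4) ∈ Set.Ioo (0:ℝ) 1 :=
      ⟨by positivity, lt_of_le_of_lt (min_le_left _ _) (by norm_num)⟩
    obtain ⟨n, hn, hn0, V, _, q, hq, h⟩ := fD R hR _ hε _ hγ n₁
    have e1 : min (1 / 2) (δ / (4 * (R + 1))) ≤ δ / (4 * (R + 1)) := min_le_right _ _
    have e2 : min (1 / 2) (δ / 4) ≤ δ / 4 := min_le_right _ _
    set ε := min (1 / 2) (δ / (4 * (R + 1)))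
    set γ := min (1 / 2) (δ / 4)
    obtain ⟨r, hr, hr2⟩ := fB V _ q hq
    have h1 : Jf WL q ≤ C := hr2.trans (le_csSup hBb hr)
    have hnr : (0:ℝ) < n := by exact_mod_cast hn0
    have h2 : Real.log 2 / n < δ / 4 := by
      have : (n₁:ℝ) ≤ n := by exact_mod_cast hn
      have h3 := hn₁.trans_le this
      rw [div_lt_iff₀ hδ0] at h3
      rw [div_lt_iff₀ hnr]
      linarith
    have h4 : ε * R ≤ δ / 4 := by
      have : ε * (4 * (R + 1)) ≤ δ := by
        rwa [le_div_iff₀ (by positivity)] at e1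
      have := hε.1
      nlinarith
    have h5 : 0 < ε * γ := mul_pos hε.1 hγ.1
    nlinarith
  by_cases hBn : B.Nonempty
  · obtain ⟨r, hr⟩ := hBn
    obtain ⟨V, _, q, hq, _⟩ := fA r hr
    obtain ⟨R, hR, _⟩ := fC V _ q hq
    apply le_antisymm
    · exact csSup_le ⟨R, hR⟩ hle
    · apply csSup_le ⟨r, hr⟩
      intro r hr
      obtain ⟨V, _, q, hq, h⟩ := fA r hr
      obtain ⟨R, hR, h'⟩ := fC V _ q hq
      exact (h.trans h').trans (le_csSup ⟨_, hle⟩ hR)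
  · have hAn : ¬ A.Nonempty := by
      rintro ⟨R, hR⟩
      obtain ⟨n, _, _, V, _, q, hq, _⟩ := fD R hR (1/2) (by norm_num) (1/2) (by norm_num) 0
      obtain ⟨r, hr, _⟩ := fB V _ q hq
      exact hBn ⟨r, hr⟩
    rw [Set.not_nonempty_iff_eq_empty.1 hBn, Set.not_nonempty_iff_eq_empty.1 hAn]


end CompoundDegraded
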